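/- arXiv:math/0510071 — 2 statements merged into one kernel-verified Lean document; each statement's English description precedes it below -/
import Mathlib

section
/- Let ν : ℂ × [0,1] → ℂ be a C^∞ function, doubly periodic in the first variable, with |ν(z,t)| < 1 for all (z,t) and ν(z,0) = 0 for all z. Then there exists a C^∞ function f : ℂ × [0,1] → ℂ, doubly periodic in the first variable, such that f(z,0) = 1 for all z, for each fixed t ∈ [0,1] the function z ↦ f(z,t) satisfies ∂f/∂z̄ = ∂(f·ν)/∂z, and for each fixed t the function z ↦ f(z,t) is not identically zero. -/
open MeasureTheory

/-- The Wirtinger derivative `∂f/∂z = (1/2)(∂f/∂x − i ∂f/∂y)` of `f` at `z`,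
where `∂f/∂x`, `∂f/∂y` are the directional derivatives in directions `1`, `i`. -/
noncomputable def wderiv (f : ℂ → ℂ) (z : ℂ) : ℂ :=
  (fderiv ℝ f z 1 - Complex.I * fderiv ℝ f z Complex.I) / 2

/-- The Wirtinger derivative `∂f/∂z̄ = (1/2)(∂f/∂x + i ∂f/∂y)` of `f` at `z`. -/
noncomputable def wderivBar (f : ℂ → ℂ) (z : ℂ) : ℂ :=
  (fderiv ℝ f z 1 + Complex.I * fderiv ℝ f z Complex.I) / 2

/-- A function on `ℂ` is doubly periodic (with periods `2π` and `2πi`). -/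
def DoublyPeriodic (f : ℂ → ℂ) : Prop :=
  ∀ z : ℂ, f (z + 2 * Real.pi) = f z ∧ f (z + 2 * Real.pi * Complex.I) = f z

noncomputable section HM
open Set

abbrev HMT : Type := UnitAddTorus (Fin 2)

def qm (z : ℂ) : HMT := fun i => (((![z.re / (2 * Real.pi), z.im / (2 * Real.pi)] : Fin 2 → ℝ) i : ℝ) : UnitAddCircle)

lemma qm_oq : IsOpenQuotientMap qm := by
  have h1 : IsOpenQuotientMap (fun x : Fin 2 → ℝ => (fun i => (x i : UnitAddCircle) : HMT)) :=
    IsOpenQuotientMap.piMap (f := fun (_ : Fin 2) (x : ℝ) => (x : UnitAddCircle))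
      (fun _ => QuotientAddGroup.isOpenQuotientMap_mk)
  let e : ℂ ≃ₜ (Fin 2 → ℝ) :=
    { toFun := fun z => ![z.re / (2 * Real.pi), z.im / (2 * Real.pi)]
      invFun := fun x => ⟨x 0 * (2 * Real.pi), x 1 * (2 * Real.pi)⟩
      left_inv := by
        intro z
        have := Real.pi_pos
        apply Complex.ext <;> simp
      right_inv := by
        intro x
        have := Real.pi_pos
        ext i; fin_cases i <;> simp
      continuous_toFun := by
        apply continuous_pi
        intro i; fin_cases i <;> simp <;> fun_prop
      continuous_invFun := by
        have : (fun x : Fin 2 → ℝ => (⟨x 0 * (2 * Real.pi), x 1 * (2 * Real.pi)⟩ : ℂ))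
          = fun x => ((x 0 * (2 * Real.pi) : ℝ) : ℂ) + ((x 1 * (2 * Real.pi) : ℝ) : ℂ) * Complex.I := by
          funext x; apply Complex.ext <;> simp
        rw [this]; fun_prop }
  exact h1.comp e.isOpenQuotientMap

lemma qm_add (z w : ℂ) : qm (z + w) = qm z + qm w := by
  funext i
  fin_cases i <;> simp [qm, add_div]

lemma qm_per {z w : ℂ} (h : qm z = qm w) :
    ∃ m n : ℤ, w = z + m * (2 * Real.pi) + n * (2 * Real.pi * Complex.I) := by
  have hp := Real.pi_pos
  have h0 := congrFun h 0
  have h1 := congrFun h 1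
  simp only [qm, Matrix.cons_val_zero, Matrix.cons_val_one] at h0 h1
  rw [← sub_eq_zero, ← AddCircle.coe_sub, AddCircle.coe_eq_zero_iff] at h0 h1
  obtain ⟨m, hm⟩ := h0
  obtain ⟨n, hn⟩ := h1
  refine ⟨-m, -n, ?_⟩
  simp only [zsmul_eq_mul, mul_one] at hm hn
  have h2 : w.re = z.re - m * (2 * Real.pi) := by rw [hm]; field_simp; ring
  have h3 : w.im = z.im - n * (2 * Real.pi) := by rw [hn]; field_simp; ring
  apply Complex.ext
  · simp [h2, sub_eq_add_neg]
  · simp [h3, sub_eq_add_neg]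

lemma qm_two_pi : qm (2 * Real.pi) = 0 := by
  have hp := Real.pi_pos.ne'
  funext i
  fin_cases i <;> simp [qm, hp]
lemma qm_two_pi_I : qm (2 * Real.pi * Complex.I) = 0 := by
  have hp := Real.pi_pos.ne'
  funext i
  fin_cases i <;> simp [qm, hp]

def lft : HMT → ℂ := Function.surjInv qm_oq.surjective
lemma qm_lft (x : HMT) : qm (lft x) = x := Function.surjInv_eq _ x

abbrev HMK : Set (ℂ × ℝ) := Set.univ ×ˢ Set.Icc (0:ℝ) 1

def HMPer {E : Type} (g : ℂ × ℝ → E) : Prop :=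
  ∀ t ∈ Set.Icc (0:ℝ) 1, ∀ z w, qm z = qm w → g (z, t) = g (w, t)

variable {E : Type} [NormedAddCommGroup E] [NormedSpace ℝ E]

def HMN (g : ℂ × ℝ → E) (p : ℂ × ℝ) : C(HMT, E) :=
  ContinuousMap.mkD (fun x => g (lft x + p.1, p.2)) 0

lemma cont_desc (g : ℂ × ℝ → E) (hg : ContinuousOn g HMK) (hp : HMPer g) :
    Continuous (fun q : HMK × HMT => g (lft q.2 + q.1.1.1, q.1.1.2)) := by
  have h := (IsOpenQuotientMap.prodMap (IsOpenQuotientMap.id (X := HMK)) qm_oq)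
  rw [← h.continuous_comp_iff]
  have : (fun q : HMK × HMT => g (lft q.2 + q.1.1.1, q.1.1.2)) ∘ Prod.map id qm
      = fun q : HMK × ℂ => g (q.2 + q.1.1.1, q.1.1.2) := by
    funext q
    refine hp _ q.1.2.2 _ _ ?_
    simp [qm_add, qm_lft]
  rw [this]
  exact hg.comp_continuous (by fun_prop) (fun q => ⟨mem_univ _, q.1.2.2⟩)

lemma HMN_apply (g : ℂ × ℝ → E) (hg : ContinuousOn g HMK) (hp : HMPer g) {p : ℂ × ℝ}
    (h : p ∈ HMK) (x : HMT) : HMN g p x = g (lft x + p.1, p.2) := by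
  have : Continuous (fun x => g (lft x + p.1, p.2)) :=
    (cont_desc g hg hp).comp (f := fun x => ((⟨p, h⟩ : HMK), x)) (by fun_prop)
  simp [HMN, ContinuousMap.mkD_of_continuous this]

lemma HMN_cont (g : ℂ × ℝ → E) (hg : ContinuousOn g HMK) (hp : HMPer g) :
    ContinuousOn (HMN g) HMK := by
  rw [continuousOn_iff_continuous_domRestrict]
  have : HMK.domRestrict (HMN g) = ContinuousMap.curry ⟨_, cont_desc g hg hp⟩ := by
    funext p
    ext x
    rw [Set.domRestrict_apply, HMN_apply g hg hp p.2]
    rfl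
  rw [this]
  exact ContinuousMap.continuous _

def HMPhi : C(HMT, (ℂ × ℝ) →L[ℝ] E) →L[ℝ] ((ℂ × ℝ) →L[ℝ] C(HMT, E)) :=
  LinearMap.mkContinuous₂
    (LinearMap.mk₂ ℝ (fun (A : C(HMT, (ℂ × ℝ) →L[ℝ] E)) (v : ℂ × ℝ) => (⟨fun x => A x v, by fun_prop⟩ : C(HMT, E)))
      (by intros; ext; simp) (by intros; ext; simp) (by intros; ext; simp) (by intros; ext; simp)) 1
    (by
      intro A v
      rw [one_mul]
      refine (ContinuousMap.norm_le _ (by positivity)).2 fun x => ?_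
      exact (ContinuousLinearMap.le_opNorm _ _).trans (by gcongr; exact A.norm_coe_le_norm x))

lemma HMPhi_apply (A : C(HMT, (ℂ × ℝ) →L[ℝ] E)) (v) (x) : HMPhi A v x = A x v := rfl

lemma HMK_unique : UniqueDiffOn ℝ HMK := uniqueDiffOn_univ.prod (uniqueDiffOn_Icc one_pos)
lemma HMK_convex : Convex ℝ HMK := convex_univ.prod (convex_Icc _ _)

open scoped Pointwise in
lemma per_fderiv (g : ℂ × ℝ → E) (hp : HMPer g) : HMPer (fderivWithin ℝ g HMK) := by
  intro t ht z w hzw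
  have h1 := fderivWithin_comp_add_right (𝕜 := ℝ) (f := g) (s := HMK) (x := (z,t)) ((w - z, 0) : ℂ × ℝ)
  have h2 : ((w - z, 0) : ℂ × ℝ) +ᵥ HMK = HMK := by
    ext ⟨a, b⟩
    rw [Set.mem_vadd_set_iff_neg_vadd_mem]
    simp
  rw [h2] at h1
  have h3 : (z, t) + (w - z, (0:ℝ)) = (w, t) := by simp
  rw [h3] at h1
  rw [← h1]
  apply fderivWithin_congr
  · rintro ⟨a, b⟩ ⟨-, hb⟩
    simp only [Prod.mk_add_mk, add_zero]
    refine hp b hb _ _ ?_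
    have : qm (w - z) = 0 := by
      have := qm_add (w - z) z
      rw [sub_add_cancel, hzw] at this
      simpa using this
    rw [qm_add, this, add_zero]
  · simp only [Prod.mk_add_mk, add_zero]
    refine hp t ht _ _ ?_
    simpa using hzw

lemma HMN_hasFDeriv (g : ℂ × ℝ → E) (hg : ContDiffOn ℝ (⊤ : ℕ∞) g HMK) (hp : HMPer g)
    {p : ℂ × ℝ} (h : p ∈ HMK) :
    HasFDerivWithinAt (HMN g) (HMPhi (HMN (fderivWithin ℝ g HMK) p)) HMK p := by
  have hd : ContinuousOn (fderivWithin ℝ g HMK) HMK :=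
    hg.continuousOn_fderivWithin HMK_unique (by simp)
  have hpd := per_fderiv g hp
  have hc := HMN_cont _ hd hpd p h
  rw [hasFDerivWithinAt_iff_isLittleO, Asymptotics.isLittleO_iff]
  intro c hc0
  rw [Metric.continuousWithinAt_iff] at hc
  obtain ⟨δ, hδ, H⟩ := hc c hc0
  have hmem : HMK ∩ Metric.ball p δ ∈ nhdsWithin p HMK :=
    inter_mem_nhdsWithin _ (Metric.ball_mem_nhds _ hδ)
  filter_upwards [hmem] with q hq
  refine (ContinuousMap.norm_le _ (by positivity)).2 fun x => ?_
  simp only [ContinuousMap.sub_apply, HMPhi_apply]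
  rw [HMN_apply g hg.continuousOn hp hq.1, HMN_apply g hg.continuousOn hp h, HMN_apply _ hd hpd h]
  refine Convex.norm_image_sub_le_of_norm_hasFDerivWithin_le' (𝕜 := ℝ)
    (f := fun r : ℂ × ℝ => g (lft x + r.1, r.2))
    (f' := fun r : ℂ × ℝ => fderivWithin ℝ g HMK (lft x + r.1, r.2)) (s := HMK ∩ Metric.ball p δ)
    ?_ ?_ (HMK_convex.inter (convex_ball _ _)) ⟨h, Metric.mem_ball_self hδ⟩ hq
  · intro r hr
    have hr' : (lft x + r.1, r.2) ∈ HMK := ⟨mem_univ _, hr.1.2⟩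
    have h1 : HasFDerivWithinAt g (fderivWithin ℝ g HMK (lft x + r.1, r.2)) HMK (lft x + r.1, r.2) :=
      ((hg _ hr').differentiableWithinAt (by simp)).hasFDerivWithinAt
    have h2 : HasFDerivWithinAt (fun r : ℂ × ℝ => (lft x + r.1, r.2))
        (ContinuousLinearMap.id ℝ (ℂ × ℝ)) (HMK ∩ Metric.ball p δ) r := by
      have : (fun r : ℂ × ℝ => (lft x + r.1, r.2)) = fun r => (lft x, (0:ℝ)) + r := by
        funext r; ext <;> simp
      rw [this]
      exact (hasFDerivWithinAt_id _ _).const_add _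
    have := h1.comp r h2 (t := HMK) (fun r hr => ⟨mem_univ _, hr.1.2⟩)
    rw [ContinuousLinearMap.comp_id] at this
    exact this
  · intro r hr
    have h1 := H hr.1 hr.2
    rw [dist_eq_norm] at h1
    have h2 := ContinuousMap.norm_coe_le_norm (HMN (fderivWithin ℝ g HMK) r - HMN (fderivWithin ℝ g HMK) p) x
    rw [ContinuousMap.sub_apply, HMN_apply _ hd hpd hr.1, HMN_apply _ hd hpd h] at h2
    exact h2.trans h1.le

lemma HMN_contDiff_nat (n : ℕ) : ∀ (E : Type) [NormedAddCommGroup E] [NormedSpace ℝ E]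
    (g : ℂ × ℝ → E) (_ : ContDiffOn ℝ (⊤ : ℕ∞) g HMK) (_ : HMPer g),
    ContDiffOn ℝ n (HMN g) HMK := by
  induction n with
  | zero =>
    intro E _ _ g hg hp
    simpa using HMN_cont g hg.continuousOn hp
  | succ n ih =>
    intro E _ _ g hg hp
    push_cast
    rw [contDiffOn_succ_iff_hasFDerivWithinAt_of_uniqueDiffOn HMK_unique]
    refine ⟨by simp, fun p => HMPhi (HMN (fderivWithin ℝ g HMK) p), ?_, fun p h => HMN_hasFDeriv g hg hp h⟩
    have hΦ : ContDiff ℝ n (HMPhi (E := E)) := ContinuousLinearMap.contDiff _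
    exact hΦ.comp_contDiffOn (ih _ _ (hg.fderivWithin HMK_unique (by simp)) (per_fderiv g hp))

lemma HMN_contDiff (g : ℂ × ℝ → E) (hg : ContDiffOn ℝ (⊤ : ℕ∞) g HMK) (hp : HMPer g) :
    ContDiffOn ℝ (⊤ : ℕ∞) (HMN g) HMK :=
  contDiffOn_infty.2 fun n => HMN_contDiff_nat n E g hg hp
end HM

noncomputable section HM2
open Set
open UnitAddTorus ENNReal

local instance hmMS : MeasureSpace UnitAddCircle := ⟨AddCircle.haarAddCircle⟩
local instance hmHaar : Measure.IsAddHaarMeasure (volume : Measure UnitAddCircle) :=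
  inferInstanceAs (Measure.IsAddHaarMeasure AddCircle.haarAddCircle)
local instance hmProb : IsProbabilityMeasure (volume : Measure UnitAddCircle) :=
  inferInstanceAs (IsProbabilityMeasure AddCircle.haarAddCircle)

abbrev HMX : Type := Lp ℂ 2 (volume : Measure HMT)

abbrev HMI : Type := Fin 2 → ℤ

def HMJ : C(HMT, ℂ) →L[ℂ] HMX := ContinuousMap.toLp 2 volume ℂ

def HMM : C(HMT, ℂ) →L[ℂ] HMX →L[ℂ] HMX :=
  ((ContinuousLinearMap.mul ℂ ℂ).holderL (volume : Measure HMT) ∞ 2 2) ∘L (ContinuousMap.toLp ∞ volume ℂ)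

lemma HMM_norm (g : C(HMT, ℂ)) : ‖HMM g‖ ≤ ‖g‖ := by
  refine ContinuousLinearMap.opNorm_le_bound _ (norm_nonneg _) fun u => ?_
  have h := (ContinuousLinearMap.mul ℂ ℂ).norm_holder_apply_apply_le (r := 2)
    (ContinuousMap.toLp ∞ (volume : Measure HMT) ℂ g) u
  have h1 : ‖ContinuousMap.toLp ∞ (volume : Measure HMT) ℂ g‖ ≤ ‖g‖ := by
    refine (ContinuousLinearMap.le_opNorm _ _).trans ?_
    have := ContinuousMap.toLp_norm_le (α := HMT) (E := ℂ) (p := ∞) (μ := volume) (𝕜 := ℂ)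
    have h2 : ‖(ContinuousMap.toLp ∞ (volume : Measure HMT) ℂ : C(HMT, ℂ) →L[ℂ] _)‖ ≤ 1 := by
      simpa using this
    nlinarith [norm_nonneg g]
  calc ‖HMM g u‖ ≤ _ := h
    _ ≤ 1 * ‖g‖ * ‖u‖ := by gcongr; simp
    _ = _ := by ring

lemma HMM_J (g f : C(HMT, ℂ)) : HMM g (HMJ f) = HMJ (g * f) := by
  apply Lp.ext
  have h1 := (ContinuousLinearMap.mul ℂ ℂ).coeFn_holder (r := 2)
    (ContinuousMap.toLp ∞ (volume : Measure HMT) ℂ g) (HMJ f)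
  have h2 := ContinuousMap.coeFn_toLp (p := ∞) (𝕜 := ℂ) (volume : Measure HMT) g
  have h3 := ContinuousMap.coeFn_toLp (p := 2) (𝕜 := ℂ) (volume : Measure HMT) f
  have h4 := ContinuousMap.coeFn_toLp (p := 2) (𝕜 := ℂ) (volume : Measure HMT) (g * f)
  refine Filter.EventuallyEq.trans h1 ?_
  filter_upwards [h2, h3, h4] with x h2 h3 h4
  simp only [HMJ] at *
  rw [h2, h3, h4]
  rfl

lemma HMJ_dense : DenseRange HMJ := ContinuousMap.toLp_denseRange ℂ volume ℂ (by simp)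

def HMb : HilbertBasis HMI ℂ HMX := mFourierBasis

lemma HMb_apply (k : HMI) : HMb k = HMJ (mFourier k) := by
  simp [HMb, HMJ]

def HMphi (k : HMI) : HMX →L[ℂ] ℂ := innerSL ℂ (HMb k)

lemma HMphi_repr (k : HMI) (u : HMX) : HMphi k u = HMb.repr u k := by
  simp [HMphi, HilbertBasis.repr_apply_apply]

lemma HMphi_ext {u v : HMX} (h : ∀ k, HMphi k u = HMphi k v) : u = v := by
  apply HMb.repr.injective
  ext k
  simpa [HMphi_repr] using h k

lemma HMphi_sum (u : HMX) : HasSum (fun k => HMphi k u • HMJ (mFourier k)) u := by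
  simpa [HMphi_repr, HMb_apply] using HMb.hasSum_repr u

lemma HMphi_J (k j : HMI) : HMphi k (HMJ (mFourier j)) = if k = j then 1 else 0 := by
  have := orthonormal_iff_ite.1 HMb.orthonormal k j
  rw [HMb_apply j] at this
  simpa [HMphi] using this

lemma HMid (u : HMX) (h : Summable (fun k => HMphi k u)) :
    ∃ F : C(HMT, ℂ), HMJ F = u ∧ ∀ x, HasSum (fun k => HMphi k u * mFourier k x) (F x) := by
  have hs : Summable (fun k => HMphi k u • mFourier k) := by
    apply Summable.of_norm
    simpa [norm_smul, mFourier_norm] using h.norm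
  obtain ⟨F, hF⟩ := hs
  refine ⟨F, ?_, fun x => ?_⟩
  · have h1 := HMJ.hasSum hF
    simp only [map_smul] at h1
    exact h1.unique (HMphi_sum u)
  · simpa using! (ContinuousMap.evalCLM ℂ x).hasSum hF

lemma HMid_unique (F : C(HMT, ℂ)) (h : Summable (fun k => HMphi k (HMJ F))) (x) :
    HasSum (fun k => HMphi k (HMJ F) * mFourier k x) (F x) := by
  obtain ⟨G, hG, hs⟩ := HMid _ h
  have : G = F := ContinuousMap.toLp_injective (p := 2) (𝕜 := ℂ) volume hG
  rw [← this] at hs ⊢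
  exact hs x

def HMTr (a : HMT) : HMX →L[ℂ] HMX :=
  (Lp.compMeasurePreservingₗᵢ ℂ (fun x : HMT => x + a)
    (measurePreserving_add_right volume a)).toContinuousLinearMap

def HMsh (a : HMT) (f : C(HMT, ℂ)) : C(HMT, ℂ) := f.comp ⟨fun x => x + a, by fun_prop⟩

lemma HMTr_J (a : HMT) (f : C(HMT, ℂ)) : HMTr a (HMJ f) = HMJ (HMsh a f) := by
  apply Lp.ext
  have hm : MeasurePreserving (fun x : HMT => x + a) volume volume := measurePreserving_add_right volume a
  have h1 := Lp.coeFn_compMeasurePreserving (HMJ f) hm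
  have h3 := ContinuousMap.coeFn_toLp (p := 2) (𝕜 := ℂ) (volume : Measure HMT) f
  have h4 := ContinuousMap.coeFn_toLp (p := 2) (𝕜 := ℂ) (volume : Measure HMT) (HMsh a f)
  have h5 := hm.quasiMeasurePreserving.ae_eq_comp h3
  refine Filter.EventuallyEq.trans h1 ?_
  exact h5.trans h4.symm

lemma HMTr_M (a : HMT) (g : C(HMT, ℂ)) (u : HMX) :
    HMTr a (HMM g u) = HMM (HMsh a g) (HMTr a u) := by
  refine congrFun (HMJ_dense.equalizer (g := fun u => HMTr a (HMM g u))
    (h := fun u => HMM (HMsh a g) (HMTr a u)) (by fun_prop) (by fun_prop) ?_) u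
  funext f
  simp only [Function.comp_apply, HMM_J, HMTr_J]
  rfl

lemma mFourier_add_pt (k : HMI) (x y : HMT) : mFourier k (x + y) = mFourier k x * mFourier k y := by
  simp [mFourier, fourier_apply, AddCircle.toCircle_add, smul_add]
  ring

lemma HMTr_phi (a : HMT) (k : HMI) (u : HMX) :
    HMphi k (HMTr a u) = mFourier k a * HMphi k u := by
  have h1 := ((HMphi k).comp (HMTr a)).hasSum (HMphi_sum u)
  have h2 := ((mFourier k a) • (HMphi k)).hasSum (HMphi_sum u)
  refine h1.unique (h2.congr_fun ?_)
  intro j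
  have : HMsh a (mFourier j) = mFourier j a • mFourier j := by
    ext x
    simp [HMsh, mFourier_add_pt, mul_comm]
  simp only [map_smul, ContinuousLinearMap.comp_apply, HMTr_J, this, HMphi_J,
    smul_apply]
  by_cases h : k = j
  · simp [h]
  · simp [h]

lemma exists_mult (m : HMI → ℂ) (hm : ∀ k, ‖m k‖ ≤ 1) :
    ∃ S : HMX →L[ℂ] HMX, ‖S‖ ≤ 1 ∧ ∀ k u, HMphi k (S u) = m k * HMphi k u := by
  have hle : ∀ (u : lp (fun _ : HMI => ℂ) 2) k, ‖m k * u k‖ ≤ ‖u k‖ := fun u k => by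
    rw [norm_mul]; exact mul_le_of_le_one_left (norm_nonneg _) (hm k)
  let D : lp (fun _ : HMI => ℂ) 2 →L[ℂ] lp (fun _ : HMI => ℂ) 2 :=
    LinearMap.mkContinuous
      { toFun := fun u => ⟨fun k => m k * u k, (lp.memℓp u).mono' (hle u)⟩
        map_add' := by intros; ext; simp [mul_add]; rfl
        map_smul' := by intros; ext; simp; ring } 1
      (by
        intro u
        rw [one_mul]
        exact lp.norm_mono (by simp) (hle u))
  have hD : ‖D‖ ≤ 1 := LinearMap.mkContinuous_norm_le _ zero_le_one _
  refine ⟨HMb.repr.symm.toLinearIsometry.toContinuousLinearMap ∘L D ∘L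
    HMb.repr.toLinearIsometry.toContinuousLinearMap, ?_, ?_⟩
  · refine ContinuousLinearMap.opNorm_le_bound _ zero_le_one fun u => ?_
    simp only [ContinuousLinearMap.comp_apply, LinearIsometry.coe_toContinuousLinearMap,
      LinearIsometryEquiv.coe_toLinearIsometry, LinearIsometryEquiv.norm_map]
    refine (D.le_opNorm _).trans ?_
    rw [LinearIsometryEquiv.norm_map]
    gcongr
  · intro k u
    simp only [HMphi_repr, ContinuousLinearMap.comp_apply, LinearIsometry.coe_toContinuousLinearMap,
      LinearIsometryEquiv.coe_toLinearIsometry, LinearIsometryEquiv.apply_symm_apply]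
    rfl

def HMw (k : HMI) : ℂ := (1 - Complex.I * k 0) * (1 - Complex.I * k 1)

lemma one_sub_sq (n : ℤ) : ‖(1 - Complex.I * n : ℂ)‖ ^ 2 = 1 + (n:ℝ) ^ 2 := by
  rw [← Complex.normSq_eq_norm_sq, Complex.normSq_apply]
  simp; ring

lemma one_sub_ne (n : ℤ) : (1 - Complex.I * n : ℂ) ≠ 0 := by
  intro h
  have := one_sub_sq n
  rw [h] at this
  simp at this
  nlinarith [sq_nonneg (n:ℝ)]

lemma HMw_ne (k : HMI) : HMw k ≠ 0 := mul_ne_zero (one_sub_ne _) (one_sub_ne _)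

lemma HMw_summable : Summable (fun k : HMI => ‖(HMw k)⁻¹‖ ^ 2) := by
  have h1 : Summable (fun n : ℤ => (1 + (n:ℝ) ^ 2)⁻¹) := by
    refine Summable.of_norm_bounded_eventually (Real.summable_one_div_int_pow.2 (one_lt_two)) ?_
    have : ∀ᶠ n : ℤ in Filter.cofinite, n ≠ 0 := (Set.finite_singleton (0:ℤ)).compl_mem_cofinite
    filter_upwards [this] with n hn
    rw [Real.norm_of_nonneg (by positivity), one_div]
    have : (0:ℝ) < (n:ℝ)^2 := by positivity
    gcongr
    linarith
  have h2 := h1.mul_of_nonneg h1 (fun n => by positivity) (fun n => by positivity)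
  rw [← (finTwoArrowEquiv ℤ).symm.summable_iff]
  refine h2.congr ?_
  intro p
  simp [HMw, mul_pow, one_sub_sq, finTwoArrowEquiv]
  ring

lemma exists_ell : ∃ l : HMX →L[ℂ] ℂ, ∀ u, HasSum (fun k => (HMw k)⁻¹ * HMphi k u) (l u) := by
  have hmem : Memℓp (fun k : HMI => (starRingEnd ℂ) (HMw k)⁻¹) 2 := by
    apply memℓp_gen
    simpa using HMw_summable
  let ψ : lp (fun _ : HMI => ℂ) 2 := ⟨_, hmem⟩
  refine ⟨(innerSL ℂ ψ) ∘L HMb.repr.toLinearIsometry.toContinuousLinearMap, fun u => ?_⟩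
  have := lp.hasSum_inner (𝕜 := ℂ) ψ (HMb.repr u)
  refine this.congr_fun fun k => ?_
  simp [ψ, HMphi_repr, mul_comm]

end HM2

noncomputable section HM3
open Set
open UnitAddTorus ENNReal

def HMsym (k : HMI) (v : ℂ) : ℂ := Complex.I * (k 0 * v.re + k 1 * v.im)

lemma mFourier_qm (k : HMI) (z : ℂ) : mFourier k (qm z) = Complex.exp (HMsym k z) := by
  have hp : (Real.pi : ℂ) ≠ 0 := by exact_mod_cast Real.pi_pos.ne'
  simp only [mFourier, ContinuousMap.coe_mk, Fin.prod_univ_two, qm, fourier_coe_apply,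
    ← Complex.exp_add]
  congr 1
  simp [HMsym]
  field_simp

lemma HMsym_add (k : HMI) (v w : ℂ) : HMsym k (v + w) = HMsym k v + HMsym k w := by
  simp [HMsym]; ring

lemma HMsym_smul (k : HMI) (s : ℝ) (w : ℂ) : HMsym k (s • w) = s * HMsym k w := by
  simp [HMsym]; ring

lemma HMsym_zero (k : HMI) : HMsym k 0 = 0 := by simp [HMsym]
lemma HMsym_one (k : HMI) : HMsym k 1 = Complex.I * k 0 := by simp [HMsym]
lemma HMsym_I (k : HMI) : HMsym k Complex.I = Complex.I * k 1 := by simp [HMsym]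

lemma exp_deriv (k : HMI) (z v : ℂ) :
    HasDerivAt (fun s : ℝ => Complex.exp (HMsym k (z + s • v)))
      (Complex.exp (HMsym k z) * HMsym k v) 0 := by
  have h1 : HasDerivAt (fun s : ℝ => HMsym k (z + s • v)) (HMsym k v) 0 := by
    simp only [HMsym_add, HMsym_smul]
    simpa using ((Complex.ofRealCLM.hasDerivAt (x := 0)).mul_const (HMsym k v)).const_add (HMsym k z)
  have := h1.cexp
  simpa using this

def HMEq (G : ℂ × ℝ → HMX) (a : HMI → ℝ → ℂ) : Prop :=
  ∀ p ∈ HMK, ∀ k, HMphi k (G p) = Complex.exp (HMsym k p.1) * a k p.2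

def HMd {E : Type} [NormedAddCommGroup E] [NormedSpace ℝ E] (G : ℂ × ℝ → E) (v : ℂ) (p : ℂ × ℝ) : E :=
  fderivWithin ℝ G HMK p (v, 0)

lemma HMd_contDiff {E : Type} [NormedAddCommGroup E] [NormedSpace ℝ E] {G : ℂ × ℝ → E}
    (hG : ContDiffOn ℝ (⊤ : ℕ∞) G HMK) (v : ℂ) : ContDiffOn ℝ (⊤ : ℕ∞) (HMd G v) HMK :=
  (hG.fderivWithin HMK_unique (by simp)).clm_apply contDiffOn_const

lemma HMd_has {E : Type} [NormedAddCommGroup E] [NormedSpace ℝ E] {G : ℂ × ℝ → E}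
    (hG : ContDiffOn ℝ (⊤ : ℕ∞) G HMK) {z : ℂ} {t : ℝ} (ht : t ∈ Icc (0:ℝ) 1) :
    HasFDerivAt (fun z => G (z, t))
      ((fderivWithin ℝ G HMK (z, t)).comp (ContinuousLinearMap.inl ℝ ℂ ℝ)) z := by
  have hp : (z, t) ∈ HMK := ⟨mem_univ _, ht⟩
  have h1 : HasFDerivWithinAt G (fderivWithin ℝ G HMK (z, t)) HMK (z, t) :=
    ((hG _ hp).differentiableWithinAt (by simp)).hasFDerivWithinAt
  have h2 : HasFDerivWithinAt (fun z : ℂ => (z, t)) (ContinuousLinearMap.inl ℝ ℂ ℝ) univ z :=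
    (hasFDerivAt_prodMk_left z t).hasFDerivWithinAt
  have := h1.comp z h2 (t := HMK) (fun r _ => ⟨mem_univ _, ht⟩)
  exact hasFDerivWithinAt_univ.1 this

lemma HMd_eq {G : ℂ × ℝ → HMX} {a : HMI → ℝ → ℂ} (hG : ContDiffOn ℝ (⊤ : ℕ∞) G HMK)
    (he : HMEq G a) (v : ℂ) : HMEq (HMd G v) (fun k t => HMsym k v * a k t) := by
  rintro ⟨z, t⟩ ⟨-, ht⟩ k
  have h1 := HMd_has hG (z := z) ht
  have h2 := (((HMphi k).restrictScalars ℝ).hasFDerivAt).comp z h1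
  have h3 : HasDerivAt (fun s : ℝ => z + s • v) v 0 := by
    simpa using ((hasDerivAt_id (0:ℝ)).smul_const v).const_add z
  have h4 := HasFDerivAt.comp_hasDerivAt_of_eq (0:ℝ) h2 h3 (by simp)
  have h5 := (exp_deriv k z v).mul_const (a k t)
  have h6 := h4.unique (h5.congr_of_eventuallyEq (Filter.Eventually.of_forall fun s => by
    exact he (z + s • v, t) ⟨mem_univ _, ht⟩ k))
  have h7 : HMphi k (HMd G v (z, t)) = Complex.exp (HMsym k z) * HMsym k v * a k t := h6
  rw [h7]; ring

lemma HMsub_eq {G H : ℂ × ℝ → HMX} {a b : HMI → ℝ → ℂ} (hG : HMEq G a) (hH : HMEq H b) :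
    HMEq (fun p => G p - H p) (fun k t => a k t - b k t) := by
  intro p hp k
  rw [map_sub, hG p hp, hH p hp]; ring

lemma HMeval {G : ℂ × ℝ → HMX} {a : HMI → ℝ → ℂ} (hG : ContDiffOn ℝ (⊤ : ℕ∞) G HMK)
    (he : HMEq G a) : ∃ F : ℂ × ℝ → ℂ, ContDiffOn ℝ (⊤ : ℕ∞) F HMK ∧
      (∀ t ∈ Icc (0:ℝ) 1, ∀ z, HasSum (fun k => Complex.exp (HMsym k z) * a k t) (F (z, t))) ∧
      (∀ t ∈ Icc (0:ℝ) 1, ∀ z v, HasSum (fun k => Complex.exp (HMsym k z) * (HMsym k v * a k t))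
        (fderiv ℝ (fun z => F (z, t)) z v)) := by
  obtain ⟨l, hl⟩ := exists_ell
  let G1 : ℂ × ℝ → HMX := fun p => G p - HMd G 1 p
  have hG1 : ContDiffOn ℝ (⊤ : ℕ∞) G1 HMK := hG.sub (HMd_contDiff hG 1)
  have he1 := HMsub_eq he (HMd_eq hG he 1)
  let Q : ℂ × ℝ → HMX := fun p => G1 p - HMd G1 Complex.I p
  have hQ : ContDiffOn ℝ (⊤ : ℕ∞) Q HMK := hG1.sub (HMd_contDiff hG1 _)
  have heQ : HMEq Q (fun k t => HMw k * a k t) := by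
    have := HMsub_eq he1 (HMd_eq hG1 he1 Complex.I)
    intro p hp k
    rw [this p hp k]
    simp only [HMsym_one, HMsym_I, HMw]
    ring
  have hlr : ContDiff ℝ (⊤ : ℕ∞) (fun u => l u) := (l.restrictScalars ℝ).contDiff
  refine ⟨fun p => l (Q p), hlr.comp_contDiffOn hQ, ?_, ?_⟩
  · intro t ht z
    refine (hl (Q (z, t))).congr_fun fun k => ?_
    rw [heQ (z, t) ⟨mem_univ _, ht⟩ k]
    field_simp [HMw_ne k]
  · intro t ht z v
    have h2 := (((l).restrictScalars ℝ).hasFDerivAt).comp z (HMd_has hQ (z := z) ht)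
    have h3 : fderiv ℝ (fun z => l (Q (z, t))) z v = l (HMd Q v (z, t)) := by
      have h4 : fderiv ℝ (fun z => l (Q (z, t))) z = _ := h2.fderiv
      rw [h4]; rfl
    rw [h3]
    refine (hl (HMd Q v (z, t))).congr_fun fun k => ?_
    rw [HMd_eq hQ heQ v (z, t) ⟨mem_univ _, ht⟩ k]
    field_simp [HMw_ne k]

end HM3


noncomputable section HM4
open UnitAddTorus ENNReal Set

lemma HMPer_of {g : ℂ × ℝ → ℂ} (h : ∀ t ∈ Set.Icc (0:ℝ) 1, DoublyPeriodic (fun z => g (z, t))) :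
    HMPer g := by
  intro t ht z w hzw
  obtain ⟨m, n, rfl⟩ := qm_per hzw
  have h1 : Function.Periodic (fun z => g (z, t)) (2 * Real.pi : ℂ) := fun z => (h t ht z).1
  have h2 : Function.Periodic (fun z => g (z, t)) (2 * Real.pi * Complex.I : ℂ) :=
    fun z => (h t ht z).2
  exact ((h2.int_mul n _).trans (h1.int_mul m z)).symm

def HMs (k : HMI) : ℂ := (HMsym k 1 - Complex.I * HMsym k Complex.I) / 2
def HMsb (k : HMI) : ℂ := (HMsym k 1 + Complex.I * HMsym k Complex.I) / 2

lemma HMs_norm (k : HMI) : ‖HMs k / HMsb k‖ ≤ 1 := by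
  have : ‖HMs k‖ = ‖HMsb k‖ := by
    rw [← sq_eq_sq₀ (norm_nonneg _) (norm_nonneg _), ← Complex.normSq_eq_norm_sq,
      ← Complex.normSq_eq_norm_sq]
    simp [HMs, HMsb, HMsym, Complex.normSq_apply]
  rw [norm_div, this]
  exact div_self_le_one _

lemma HMsb_zero {k : HMI} (h : HMsb k = 0) : k = 0 := by
  have h1 := congrArg Complex.re h
  have h2 := congrArg Complex.im h
  simp [HMsb, HMsym] at h1 h2
  funext i
  fin_cases i
  · exact h2
  · exact h1

lemma HMs_zero : HMs 0 = 0 := by simp [HMs, HMsym]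

theorem homotopy_aux (ν : ℂ × ℝ → ℂ)
    (hν : ContDiffOn ℝ (⊤ : ℕ∞) ν HMK) (hp : HMPer ν)
    (hbound : ∀ z : ℂ, ∀ t ∈ Set.Icc (0:ℝ) 1, ‖ν (z, t)‖ < 1) :
    ∃ (G : ℂ × ℝ → HMX) (a b : HMI → ℝ → ℂ), ContDiffOn ℝ (⊤ : ℕ∞) G HMK ∧ HMEq G a ∧
      ContDiffOn ℝ (⊤ : ℕ∞) (fun p => HMM (HMN ν p) (G p)) HMK ∧
      HMEq (fun p => HMM (HMN ν p) (G p)) b ∧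
      (∀ t ∈ Set.Icc (0:ℝ) 1, ∀ k, a k t = (if k = 0 then 1 else 0) + HMs k / HMsb k * b k t) := by
  obtain ⟨S, hS1, hS⟩ := exists_mult (fun k => HMs k / HMsb k) HMs_norm
  let A : ℂ × ℝ → (HMX →L[ℂ] HMX) := fun p => S * HMM (HMN ν p)
  have hN : ∀ p ∈ HMK, ‖HMN ν p‖ < 1 := by
    intro p hpK
    rw [ContinuousMap.norm_lt_iff _ one_pos]
    intro x
    rw [HMN_apply ν hν.continuousOn hp hpK]
    exact hbound _ _ hpK.2
  have hA : ∀ p ∈ HMK, ‖A p‖ < 1 := by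
    intro p hpK
    calc ‖A p‖ ≤ ‖S‖ * ‖HMM (HMN ν p)‖ := norm_mul_le _ _
      _ ≤ 1 * ‖HMN ν p‖ := by gcongr; exact HMM_norm _
      _ < 1 := by rw [one_mul]; exact hN p hpK
  have hU : ∀ p ∈ HMK, IsUnit (1 - A p) := fun p hpK => isUnit_one_sub_of_norm_lt_one (hA p hpK)
  let G : ℂ × ℝ → HMX := fun p => Ring.inverse (1 - A p) (HMJ 1)
  have hMN : ContDiffOn ℝ (⊤ : ℕ∞) (fun p => HMM (HMN ν p)) HMK := by
    have h1 : ContDiff ℝ (⊤ : ℕ∞) (fun g => HMM g) := (HMM.restrictScalars ℝ).contDiff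
    exact h1.comp_contDiffOn (HMN_contDiff ν hν hp)
  have hAc : ContDiffOn ℝ (⊤ : ℕ∞) (fun p => 1 - A p) HMK := by
    exact contDiffOn_const.sub (contDiffOn_const.mul hMN)
  have hinv : ContDiffOn ℝ (⊤ : ℕ∞) (fun p => Ring.inverse (1 - A p)) HMK := by
    intro p hpK
    obtain ⟨u, hu⟩ := hU p hpK
    have h1 := contDiffAt_ringInverse (n := ((⊤ : ℕ∞) : WithTop ℕ∞)) ℝ u
    rw [hu] at h1
    exact h1.comp_contDiffWithinAt p (hAc p hpK)
  have hev : ∀ x : HMX, ContDiff ℝ (⊤ : ℕ∞) (fun B : HMX →L[ℂ] HMX => B x) := fun x =>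
    ((ContinuousLinearMap.apply ℂ HMX x).restrictScalars ℝ).contDiff
  have hG : ContDiffOn ℝ (⊤ : ℕ∞) G HMK := (hev _).comp_contDiffOn hinv
  have hH : ContDiffOn ℝ (⊤ : ℕ∞) (fun p => HMM (HMN ν p) (G p)) HMK := by
    have h1 : ContDiffOn ℝ (⊤ : ℕ∞) (fun p => HMM (HMN ν p) * Ring.inverse (1 - A p)) HMK :=
      hMN.mul hinv
    exact (hev (HMJ 1)).comp_contDiffOn h1
  have hGeq : ∀ p ∈ HMK, G p = HMJ 1 + S (HMM (HMN ν p) (G p)) := by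
    intro p hpK
    have h1 := Ring.mul_inverse_cancel _ (hU p hpK)
    have h2 := congrArg (fun B : HMX →L[ℂ] HMX => B (HMJ 1)) h1
    have h3 : G p - S (HMM (HMN ν p) (G p)) = HMJ 1 := h2
    rw [← h3]; abel
  have hGuniq : ∀ p ∈ HMK, ∀ u, u = HMJ 1 + S (HMM (HMN ν p) u) → u = G p := by
    intro p hpK u hu
    have h1 := Ring.inverse_mul_cancel _ (hU p hpK)
    have h2 := congrArg (fun B : HMX →L[ℂ] HMX => B u) h1
    have h3 : (1 - A p) u = HMJ 1 := by
      have : (1 - A p) u = u - S (HMM (HMN ν p) u) := rfl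
      rw [this, sub_eq_iff_eq_add]
      exact hu
    have h4 : Ring.inverse (1 - A p) ((1 - A p) u) = u := h2
    rw [h3] at h4
    exact h4.symm
  have hsh : ∀ z, ∀ t ∈ Icc (0:ℝ) 1, HMN ν (z, t) = HMsh (qm z) (HMN ν (0, t)) := by
    intro z t ht
    ext x
    have : HMsh (qm z) (HMN ν (0, t)) x = HMN ν (0, t) (x + qm z) := rfl
    rw [this, HMN_apply ν hν.continuousOn hp ⟨mem_univ _, ht⟩,
      HMN_apply ν hν.continuousOn hp ⟨mem_univ _, ht⟩]
    refine hp t ht _ _ ?_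
    simp [qm_add, qm_lft]
  have hTr : ∀ z, ∀ t ∈ Icc (0:ℝ) 1, HMTr (qm z) (G (0, t)) = G (z, t) := by
    intro z t ht
    apply hGuniq _ ⟨mem_univ _, ht⟩
    conv_lhs => rw [hGeq (0, t) ⟨mem_univ _, ht⟩]
    rw [map_add, HMTr_J, hsh z t ht, ← HMTr_M]
    congr 1
    apply HMphi_ext
    intro k
    rw [HMTr_phi, hS, hS, HMTr_phi]
    ring
  refine ⟨G, fun k t => HMphi k (G (0, t)), fun k t => HMphi k (HMM (HMN ν (0, t)) (G (0, t))),
    hG, ?_, hH, ?_, ?_⟩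
  · rintro ⟨z, t⟩ ⟨-, ht⟩ k
    simp only
    rw [← hTr z t ht, HMTr_phi, mFourier_qm]
  · rintro ⟨z, t⟩ ⟨-, ht⟩ k
    simp only
    rw [← hTr z t ht, hsh z t ht, ← HMTr_M, HMTr_phi, mFourier_qm]
  · intro t ht k
    simp only
    conv_lhs => rw [hGeq (0, t) ⟨mem_univ _, ht⟩]
    rw [map_add, hS, ← mFourier_zero, HMphi_J]

end HM4

/-- **Homotopy method: variable holomorphic differential (Lemma 2).**
Let `ν : ℂ × [0,1] → ℂ` be a `C^∞` family, doubly periodic in `z`, with `|ν| < 1` and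
`ν(·,0) ≡ 0`. Then there is a `C^∞` family `f : ℂ × [0,1] → ℂ`, doubly periodic in `z`,
with `f(·,0) ≡ 1`, solving `∂f/∂z̄ = ∂(f ν)/∂z` for each fixed `t`, and such that
for each `t` the function `f(·,t)` does not vanish identically. -/
theorem homotopy_method_solution
    (ν : ℂ × ℝ → ℂ)
    (hν : ContDiffOn ℝ (⊤ : ℕ∞) ν (Set.univ ×ˢ Set.Icc (0:ℝ) 1))
    (hper : ∀ t ∈ Set.Icc (0:ℝ) 1, DoublyPeriodic (fun z => ν (z, t)))
    (hbound : ∀ z : ℂ, ∀ t ∈ Set.Icc (0:ℝ) 1, ‖ν (z, t)‖ < 1)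
    (hzero : ∀ z : ℂ, ν (z, 0) = 0) :
    ∃ f : ℂ × ℝ → ℂ,
      ContDiffOn ℝ (⊤ : ℕ∞) f (Set.univ ×ˢ Set.Icc (0:ℝ) 1) ∧
      (∀ t ∈ Set.Icc (0:ℝ) 1, DoublyPeriodic (fun z => f (z, t))) ∧
      (∀ z : ℂ, f (z, 0) = 1) ∧
      (∀ t ∈ Set.Icc (0:ℝ) 1, ∀ z : ℂ,
        wderivBar (fun w => f (w, t)) z = wderiv (fun w => f (w, t) * ν (w, t)) z) ∧
      ∀ t ∈ Set.Icc (0:ℝ) 1, ∃ z : ℂ, f (z, t) ≠ 0 := by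
  have hp := HMPer_of hper
  obtain ⟨G, a, b, hG, heG, hH, heH, hab⟩ := homotopy_aux ν hν hp hbound
  obtain ⟨F, hF, hFs, hFd⟩ := HMeval hG heG
  obtain ⟨W, hW, hWs, hWd⟩ := HMeval hH heH
  have hK : ∀ (z : ℂ), ∀ t ∈ Set.Icc (0:ℝ) 1, (z, t) ∈ HMK := fun z t ht => ⟨Set.mem_univ _, ht⟩
  have ha : ∀ t ∈ Set.Icc (0:ℝ) 1, ∀ k, HMphi k (G (0, t)) = a k t := by
    intro t ht k
    rw [heG (0, t) (hK 0 t ht) k]; simp [HMsym_zero]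
  have hb : ∀ t ∈ Set.Icc (0:ℝ) 1, ∀ k, HMphi k (HMM (HMN ν (0, t)) (G (0, t))) = b k t := by
    intro t ht k
    rw [heH (0, t) (hK 0 t ht) k]; simp [HMsym_zero]
  have hrep : ∀ t ∈ Set.Icc (0:ℝ) 1, ∃ f : C(HMT, ℂ), HMJ f = G (0, t) ∧
      ∀ z, f (qm z) = F (z, t) := by
    intro t ht
    have hs : Summable (fun k => HMphi k (G (0, t))) := by
      simpa [ha t ht, HMsym_zero] using (hFs t ht 0).summable
    obtain ⟨f, h1, h2⟩ := HMid _ hs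
    refine ⟨f, h1, fun z => (h2 (qm z)).unique ((hFs t ht z).congr_fun fun k => ?_)⟩
    rw [mFourier_qm, ha t ht, mul_comm]
  have hprod : ∀ t ∈ Set.Icc (0:ℝ) 1, ∀ z, F (z, t) * ν (z, t) = W (z, t) := by
    intro t ht z
    obtain ⟨f, h1, h2⟩ := hrep t ht
    have h3 : HMM (HMN ν (0, t)) (G (0, t)) = HMJ (HMN ν (0, t) * f) := by rw [← h1, HMM_J]
    have hb' := hb t ht
    rw [h3] at hb'
    have hs : Summable (fun k => HMphi k (HMJ (HMN ν (0, t) * f))) := by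
      simpa [hb', HMsym_zero] using (hWs t ht 0).summable
    have h4 := HMid_unique _ hs (qm z)
    have h5 : (HMN ν (0, t) * f) (qm z) = W (z, t) := by
      refine h4.unique ((hWs t ht z).congr_fun fun k => ?_)
      rw [mFourier_qm, hb', mul_comm]
    rw [← h5, ContinuousMap.mul_apply, h2, HMN_apply ν hν.continuousOn hp (hK 0 t ht), mul_comm]
    congr 1
    refine hp t ht _ _ ?_
    simp [qm_lft]
  have hexp : ∀ k z c, qm c = 0 → Complex.exp (HMsym k (z + c)) = Complex.exp (HMsym k z) := by
    intro k z c hc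
    rw [← mFourier_qm, ← mFourier_qm, qm_add, hc, add_zero]
  have hFper : ∀ t ∈ Set.Icc (0:ℝ) 1, ∀ z c, qm c = 0 → F (z + c, t) = F (z, t) := by
    intro t ht z c hc
    refine (hFs t ht (z + c)).unique ((hFs t ht z).congr_fun fun k => ?_)
    rw [hexp k z c hc]
  refine ⟨F, hF, ?_, ?_, ?_, ?_⟩
  · intro t ht z
    exact ⟨hFper t ht z _ qm_two_pi, hFper t ht z _ qm_two_pi_I⟩
  · intro z
    have h0 : (0:ℝ) ∈ Set.Icc (0:ℝ) 1 := by simp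
    have hN0 : HMN ν (0, 0) = 0 := by
      ext x
      rw [HMN_apply ν hν.continuousOn hp (hK 0 0 h0)]
      simp [hzero]
    have hb0 : ∀ k, b k 0 = 0 := by
      intro k
      rw [← hb 0 h0 k, hN0]
      simp
    have h1 := hFs 0 h0 z
    refine h1.unique ?_
    have h2 : HasSum (fun k : HMI => if k = 0 then (1:ℂ) else 0) 1 := hasSum_ite_eq 0 1
    refine h2.congr_fun fun k => ?_
    rw [hab 0 h0, hb0]
    by_cases hk : k = 0
    · simp [hk, HMsym]
    · simp [hk]
  · intro t ht z
    have e : (fun w => F (w, t) * ν (w, t)) = fun w => W (w, t) := by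
      funext w; exact hprod t ht w
    rw [e]
    have h1 := (((hFd t ht z 1).add ((hFd t ht z Complex.I).mul_left Complex.I)).div_const 2)
    have h2 := (((hWd t ht z 1).sub ((hWd t ht z Complex.I).mul_left Complex.I)).div_const 2)
    refine h1.unique (h2.congr_fun fun k => ?_)
    have h3 : HMsb k * a k t = HMs k * b k t := by
      rw [hab t ht]
      by_cases hk : HMsb k = 0
      · have := HMsb_zero hk
        subst this
        rw [hk, HMs_zero]; ring
      · have hk0 : k ≠ 0 := by
          rintro rfl
          apply hk
          simp [HMsb, HMsym]
        rw [if_neg hk0]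
        field_simp
        ring
    simp only [HMs, HMsb] at h3
    linear_combination (Complex.exp (HMsym k z)) * h3
  · intro t ht
    by_contra hcon
    push Not at hcon
    obtain ⟨f, h1, h2⟩ := hrep t ht
    have hf : f = 0 := by
      ext x
      rw [← qm_lft x, h2, hcon]; rfl
    have h3 := ha t ht 0
    rw [← h1, hf, hab t ht, HMs_zero] at h3
    simp at h3
end

section
/- (Local integrability of smooth almost complex structures, Korn–Lichtenstein.) Let D ⊆ ℂ be an open disc centered at 0 and let μ : D → ℂ be a C^∞ function with |μ(z)| < 1 for all z ∈ D. Then there exist an open neighborhood U ⊆ D of 0 and an injective C^∞ map w : U → ℂ such that ∂w/∂z̄ = μ·∂w/∂z on U and ∂w/∂z(z) ≠ 0 for all z ∈ U. -/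
open MeasureTheory

namespace KL
open scoped ComplexConjugate ENNReal Topology

/-- the real-linear map `A v + B conj v` -/
noncomputable def lin (A B : ℂ) : ℂ →L[ℝ] ℂ :=
  A • (ContinuousLinearMap.id ℝ ℂ) + B • (Complex.conjCLE : ℂ →L[ℝ] ℂ)

lemma lin_apply (A B v : ℂ) : lin A B v = A * v + B * conj v := by
  simp [lin]

lemma norm_lin_le (A B : ℂ) : ‖lin A B‖ ≤ ‖A‖ + ‖B‖ := by
  refine ContinuousLinearMap.opNorm_le_bound _ (by positivity) fun v => ?_
  rw [lin_apply]
  refine (norm_add_le _ _).trans ?_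
  simp [add_mul]

lemma wderiv_of {w : ℂ → ℂ} {A B z : ℂ} (h : HasFDerivAt w (lin A B) z) :
    wderiv w z = A := by
  rw [wderiv, h.fderiv, lin_apply, lin_apply]
  simp only [map_one, Complex.conj_I]
  linear_combination (-A + B) / 2 * Complex.I_mul_I

lemma wderivBar_of {w : ℂ → ℂ} {A B z : ℂ} (h : HasFDerivAt w (lin A B) z) :
    wderivBar w z = B := by
  rw [wderivBar, h.fderiv, lin_apply, lin_apply]
  simp only [map_one, Complex.conj_I]
  linear_combination (A - B) / 2 * Complex.I_mul_I

/-- the character -/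
noncomputable def ee (ξ z : ℂ) : ℂ :=
  Complex.exp (Real.pi * Complex.I * (conj ξ * z + ξ * conj z))

lemma ee_real (ξ z : ℂ) : ee ξ z = Complex.exp ((2 * Real.pi * (conj ξ * z).re : ℝ) * Complex.I) := by
  rw [ee]
  congr 1
  have h : conj ξ * z + ξ * conj z = (2 * (conj ξ * z).re : ℝ) := by
    have := Complex.add_conj (conj ξ * z)
    simpa using this
  rw [h]; push_cast; ring

lemma norm_ee (ξ z : ℂ) : ‖ee ξ z‖ = 1 := by
  rw [ee_real]; exact Complex.norm_exp_ofReal_mul_I _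

lemma ee_add (ξ η z : ℂ) : ee (ξ + η) z = ee ξ z * ee η z := by
  rw [ee, ee, ee, ← Complex.exp_add]; congr 1; simp; ring

lemma measurable_ee (z : ℂ) : Measurable (fun ξ => ee ξ z) := by
  unfold ee
  have : Continuous (fun ξ : ℂ => Complex.exp (Real.pi * Complex.I * (conj ξ * z + ξ * conj z))) := by
    fun_prop
  exact this.measurable

lemma hasFDerivAt_ee (ξ z : ℂ) : HasFDerivAt (fun z => ee ξ z)
    (lin (ee ξ z * (Real.pi * Complex.I * conj ξ)) (ee ξ z * (Real.pi * Complex.I * ξ))) z := by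
  have h1 : HasFDerivAt (fun z : ℂ => (Real.pi * Complex.I * (conj ξ * z + ξ * conj z) : ℂ))
      (lin (Real.pi * Complex.I * conj ξ) (Real.pi * Complex.I * ξ)) z := by
    have := (lin (Real.pi * Complex.I * conj ξ) (Real.pi * Complex.I * ξ)).hasFDerivAt (x := z)
    refine this.congr_of_eventuallyEq (Filter.Eventually.of_forall fun v => ?_)
    simp only [lin_apply]; ring
  have h2 := (Complex.hasDerivAt_exp (Real.pi * Complex.I * (conj ξ * z + ξ * conj z))).hasFDerivAt.restrictScalars ℝ
  have h3 := h2.comp z h1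
  refine h3.congr_fderiv ?_
  ext v
  simp [lin_apply, ee]
  all_goals ring

/-- inverse Fourier transform -/
noncomputable def T (b : ℂ → ℂ) (z : ℂ) : ℂ := ∫ ξ, ee ξ z * b ξ

/-- its primitive version -/
noncomputable def P (m : ℂ → ℂ) (z : ℂ) : ℂ := ∫ ξ, m ξ * (ee ξ z - 1)

lemma integrable_ee_mul {b : ℂ → ℂ} (hb : Integrable b) (z : ℂ) :
    Integrable (fun ξ => ee ξ z * b ξ) :=
  hb.bdd_mul (c := 1) (measurable_ee z).aestronglyMeasurable
    (Filter.Eventually.of_forall fun ξ => (norm_ee ξ z).le)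

lemma norm_ee_sub_one (ξ z : ℂ) : ‖ee ξ z - 1‖ ≤ 2 * Real.pi * ‖ξ‖ * ‖z‖ := by
  rw [ee_real, mul_comm (Complex.ofReal _)]
  refine (Real.norm_exp_I_mul_ofReal_sub_one_le).trans ?_
  rw [norm_mul, Real.norm_of_nonneg (by positivity), mul_assoc (2 * Real.pi)]
  gcongr
  refine (Complex.abs_re_le_norm _).trans ?_
  simp

lemma hasFDerivAt_P {m : ℂ → ℂ} (hm : AEStronglyMeasurable m)
    (hi : Integrable (fun ξ => ξ * m ξ)) (z : ℂ) :
    HasFDerivAt (P m) (lin (T (fun ξ => Real.pi * Complex.I * conj ξ * m ξ) z)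
      (T (fun ξ => Real.pi * Complex.I * ξ * m ξ) z)) z := by
  have hi2 : Integrable (fun ξ => Real.pi * Complex.I * ξ * m ξ) := by
    simpa only [mul_assoc] using hi.const_mul (Real.pi * Complex.I)
  have hi1 : Integrable (fun ξ => Real.pi * Complex.I * conj ξ * m ξ) := by
    refine hi2.mono ?_ (Filter.Eventually.of_forall fun ξ => by simp)
    have : Continuous (fun ξ : ℂ => Real.pi * Complex.I * conj ξ) := by fun_prop
    exact this.aestronglyMeasurable.mul hm
  have key := hasFDerivAt_integral_of_dominated_of_fderiv_le (𝕜 := ℝ) (μ := volume) (x₀ := z)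
    (s := Set.univ)
    (F := fun z ξ => m ξ * (ee ξ z - 1))
    (F' := fun z ξ => lin (ee ξ z * (Real.pi * Complex.I * conj ξ * m ξ))
        (ee ξ z * (Real.pi * Complex.I * ξ * m ξ)))
    (bound := fun ξ => 2 * ‖Real.pi * Complex.I * ξ * m ξ‖) Filter.univ_mem
    (Filter.Eventually.of_forall fun z => hm.mul ((measurable_ee z).sub_const 1).aestronglyMeasurable)
    ?_ ?_ ?_ ?_ ?_
  · refine key.congr_fderiv ?_
    unfold lin
    rw [integral_add, integral_smul_const, integral_smul_const]
    · rfl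
    · exact (integrable_ee_mul hi1 z).smul_const _
    · exact (integrable_ee_mul hi2 z).smul_const _
  · refine ((hi.norm.const_mul (2 * Real.pi * ‖z‖))).mono' (hm.mul ((measurable_ee z).sub_const 1).aestronglyMeasurable) (Filter.Eventually.of_forall fun ξ => ?_)
    rw [norm_mul, norm_mul]
    have := mul_le_mul_of_nonneg_left (norm_ee_sub_one ξ z) (norm_nonneg (m ξ))
    linarith
  · unfold lin
    have q1 := ((integrable_ee_mul hi1 z).smul_const (ContinuousLinearMap.id ℝ ℂ)).aestronglyMeasurable
    have q2 := ((integrable_ee_mul hi2 z).smul_const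
      (Complex.conjCLE : ℂ →L[ℝ] ℂ)).aestronglyMeasurable
    exact q1.add q2
  · refine Filter.Eventually.of_forall fun ξ z _ => (norm_lin_le _ _).trans ?_
    simp only [norm_mul, norm_ee, RCLike.norm_conj]
    apply le_of_eq; ring
  · exact hi2.norm.const_mul 2
  · refine Filter.Eventually.of_forall fun ξ z _ => ?_
    have := ((hasFDerivAt_ee ξ z).sub_const 1).const_mul (m ξ)
    refine this.congr_fderiv ?_
    ext v
    simp [lin_apply]
    all_goals ring

/-- rapidly decaying functions -/
def Wt (b : ℂ → ℂ) : Prop :=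
  AEStronglyMeasurable b ∧ ∀ N : ℕ, ∫⁻ ξ, (1 + ‖ξ‖ₑ) ^ N * ‖b ξ‖ₑ ≠ ∞

lemma Wt.integrable {b : ℂ → ℂ} (hb : Wt b) : Integrable b := by
  refine ⟨hb.1, ?_⟩
  have := hb.2 0
  simp only [pow_zero, one_mul] at this
  exact lt_of_le_of_ne le_top this

lemma Wt.mul {b s : ℂ → ℂ} (hb : Wt b) (hs : AEStronglyMeasurable s) {K : ℝ≥0∞} (hK : K ≠ ∞)
    (h : ∀ ξ, ‖s ξ‖ₑ ≤ K * (1 + ‖ξ‖ₑ)) : Wt (fun ξ => s ξ * b ξ) := by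
  refine ⟨hs.mul hb.1, fun N => ?_⟩
  have := ENNReal.mul_ne_top hK (hb.2 (N + 1))
  rw [← lintegral_const_mul' _ _ hK] at this
  refine ne_top_of_le_ne_top this (lintegral_mono fun ξ => ?_)
  rw [enorm_mul]
  calc _ ≤ (1 + ‖ξ‖ₑ) ^ N * ((K * (1 + ‖ξ‖ₑ)) * ‖b ξ‖ₑ) := by gcongr; exact h ξ
    _ = _ := by ring

lemma T_eq {b : ℂ → ℂ} (hb : Integrable b) : T b = fun z => P b z + ∫ ξ, b ξ := by
  ext z
  rw [T, P, ← integral_add _ hb]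
  · congr 1; ext ξ; ring
  · have := (integrable_ee_mul hb z).sub hb
    refine this.congr (Filter.Eventually.of_forall fun ξ => ?_)
    simp only [Pi.sub_apply]; ring

lemma Wt.mulξ {b : ℂ → ℂ} (hb : Wt b) : Wt (fun ξ => ξ * b ξ) :=
  hb.mul aestronglyMeasurable_id ENNReal.one_ne_top (fun ξ => by simp)

lemma contDiff_nat (n : ℕ) : ∀ b : ℂ → ℂ, Wt b → ContDiff ℝ n (T b) := by
  induction n with
  | zero =>
    intro b hb
    refine contDiff_zero.2 ?_
    rw [T_eq hb.integrable]
    refine Continuous.add ?_ continuous_const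
    exact continuous_iff_continuousAt.2 fun z => (hasFDerivAt_P hb.1 hb.mulξ.integrable z).continuousAt
  | succ n ih =>
    intro b hb
    have hd : ∀ z, HasFDerivAt (T b) (lin (T (fun ξ => Real.pi * Complex.I * conj ξ * b ξ) z)
      (T (fun ξ => Real.pi * Complex.I * ξ * b ξ) z)) z := by
      intro z
      rw [T_eq hb.integrable]
      exact (hasFDerivAt_P hb.1 hb.mulξ.integrable z).add_const _
    have e : ∀ ξ : ℂ, ‖(Real.pi * Complex.I * ξ : ℂ)‖ₑ ≤ ‖(Real.pi * Complex.I : ℂ)‖ₑ * (1 + ‖ξ‖ₑ) := by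
      intro ξ; rw [enorm_mul]; gcongr; simp
    have h1 : Wt (fun ξ => Real.pi * Complex.I * conj ξ * b ξ) :=
      hb.mul (Continuous.aestronglyMeasurable (by fun_prop)) enorm_ne_top
        (fun ξ => by
          have := e (conj ξ)
          rwa [show ‖conj ξ‖ₑ = ‖ξ‖ₑ by rw [← ofReal_norm, ← ofReal_norm, RCLike.norm_conj]] at this)
    have h2 : Wt (fun ξ => Real.pi * Complex.I * ξ * b ξ) :=
      hb.mul (Continuous.aestronglyMeasurable (by fun_prop)) enorm_ne_top e
    push_cast
    rw [contDiff_succ_iff_fderiv]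
    refine ⟨fun z => (hd z).differentiableAt, by simp, ?_⟩
    have : fderiv ℝ (T b) = fun z => lin (T (fun ξ => Real.pi * Complex.I * conj ξ * b ξ) z)
      (T (fun ξ => Real.pi * Complex.I * ξ * b ξ) z) := funext fun z => (hd z).fderiv
    rw [this]; unfold lin
    exact ((ih _ h1).smul contDiff_const).add ((ih _ h2).smul contDiff_const)

lemma contDiff_T {b : ℂ → ℂ} (hb : Wt b) : ContDiff ℝ (⊤ : ℕ∞) (T b) :=
  contDiff_infty.2 fun n => contDiff_nat n b hb

/-- Neumann series terms -/
noncomputable def bs (a s : ℂ → ℂ) : ℕ → ℂ → ℂ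
  | 0 => a
  | k + 1 => fun ξ => ∫ η, a (ξ - η) * (s η * bs a s k η)

lemma measurable_bs {a s : ℂ → ℂ} (ha : Measurable a) (hs : Measurable s) (k : ℕ) :
    Measurable (bs a s k) := by
  induction k with
  | zero => exact ha
  | succ k ih =>
    have : StronglyMeasurable (Function.uncurry fun ξ η : ℂ => a (ξ - η) * (s η * bs a s k η)) := by
      apply Measurable.stronglyMeasurable
      unfold Function.uncurry
      fun_prop
    exact this.integral_prod_right.measurable

lemma lintegral_bs {a s : ℂ → ℂ} (ha : Measurable a) (hs : Measurable s) {K : ℝ≥0∞}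
    (hK : ∀ ξ, ‖s ξ‖ₑ ≤ K) {W : ℂ → ℝ≥0∞} (hW : Measurable W)
    (hadd : ∀ ξ η, W (ξ + η) ≤ W ξ * W η) (k : ℕ) :
    ∫⁻ ξ, W ξ * ‖bs a s k ξ‖ₑ ≤
      (∫⁻ ξ, W ξ * ‖a ξ‖ₑ) * (K * ∫⁻ ξ, W ξ * ‖a ξ‖ₑ) ^ k := by
  induction k with
  | zero => simp [bs]
  | succ k ih =>
    have hb := measurable_bs ha hs k
    calc ∫⁻ ξ, W ξ * ‖bs a s (k + 1) ξ‖ₑ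
        ≤ ∫⁻ ξ, ∫⁻ η, (W (ξ - η) * ‖a (ξ - η)‖ₑ) * (K * (W η * ‖bs a s k η‖ₑ)) := by
          refine lintegral_mono fun ξ => ?_
          calc W ξ * ‖bs a s (k + 1) ξ‖ₑ
              ≤ W ξ * ∫⁻ η, ‖a (ξ - η) * (s η * bs a s k η)‖ₑ := by
                gcongr
                exact enorm_integral_le_lintegral_enorm _
            _ = ∫⁻ η, W ξ * ‖a (ξ - η) * (s η * bs a s k η)‖ₑ := by
                rw [lintegral_const_mul]
                fun_prop
            _ ≤ _ := by
                refine lintegral_mono fun η => ?_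
                have h1 : W ξ ≤ W (ξ - η) * W η := by
                  simpa using hadd (ξ - η) η
                rw [enorm_mul, enorm_mul]
                calc _ ≤ (W (ξ - η) * W η) * (‖a (ξ - η)‖ₑ * (K * ‖bs a s k η‖ₑ)) := by
                      gcongr
                      exact hK η
                  _ = _ := by ring
      _ = ∫⁻ η, ∫⁻ ξ, (W (ξ - η) * ‖a (ξ - η)‖ₑ) * (K * (W η * ‖bs a s k η‖ₑ)) := by
          refine lintegral_lintegral_swap (Measurable.aemeasurable ?_)
          unfold Function.uncurry
          fun_prop
      _ = ∫⁻ η, (∫⁻ ξ, W ξ * ‖a ξ‖ₑ) * (K * (W η * ‖bs a s k η‖ₑ)) := by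
          refine lintegral_congr fun η => ?_
          rw [lintegral_mul_const _ (by fun_prop),
            lintegral_sub_right_eq_self (fun ξ => W ξ * ‖a ξ‖ₑ) η]
      _ = (∫⁻ ξ, W ξ * ‖a ξ‖ₑ) * (K * ∫⁻ η, W η * ‖bs a s k η‖ₑ) := by
          rw [lintegral_const_mul _ (by fun_prop), lintegral_const_mul _ (by fun_prop)]
      _ ≤ _ := by
          rw [pow_succ]
          calc _ ≤ (∫⁻ ξ, W ξ * ‖a ξ‖ₑ) * (K * ((∫⁻ ξ, W ξ * ‖a ξ‖ₑ) * (K * ∫⁻ ξ, W ξ * ‖a ξ‖ₑ) ^ k)) := by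
                gcongr
            _ = _ := by ring

/-- Neumann series sum -/
noncomputable def bsum (a s : ℂ → ℂ) (ξ : ℂ) : ℂ := ∑' k, bs a s k ξ

lemma tsum_lintegral_bs {a s : ℂ → ℂ} (ha : Measurable a) (hs : Measurable s) {K : ℝ≥0∞}
    (hK : ∀ ξ, ‖s ξ‖ₑ ≤ K) {W : ℂ → ℝ≥0∞} (hW : Measurable W)
    (hadd : ∀ ξ η, W (ξ + η) ≤ W ξ * W η) :
    ∑' k, ∫⁻ ξ, W ξ * ‖bs a s k ξ‖ₑ ≤
      (∫⁻ ξ, W ξ * ‖a ξ‖ₑ) * (1 - K * ∫⁻ ξ, W ξ * ‖a ξ‖ₑ)⁻¹ := by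
  refine (ENNReal.tsum_le_tsum (lintegral_bs ha hs hK hW hadd)).trans ?_
  rw [ENNReal.tsum_mul_left, ENNReal.tsum_geometric]

lemma lintegral_bsum {a s : ℂ → ℂ} (ha : Measurable a) (hs : Measurable s) {K : ℝ≥0∞}
    (hK : ∀ ξ, ‖s ξ‖ₑ ≤ K) {W : ℂ → ℝ≥0∞} (hW : Measurable W)
    (hadd : ∀ ξ η, W (ξ + η) ≤ W ξ * W η) :
    ∫⁻ ξ, W ξ * ‖bsum a s ξ‖ₑ ≤
      (∫⁻ ξ, W ξ * ‖a ξ‖ₑ) * (1 - K * ∫⁻ ξ, W ξ * ‖a ξ‖ₑ)⁻¹ := by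
  refine le_trans ?_ (tsum_lintegral_bs ha hs hK hW hadd)
  rw [← lintegral_tsum]
  · refine lintegral_mono fun ξ => ?_
    rw [ENNReal.tsum_mul_left]
    gcongr
    exact enorm_tsum_le_tsum_enorm
  · intro k
    have := measurable_bs ha hs k
    exact Measurable.aemeasurable (by fun_prop)

lemma measurable_bsum {a s : ℂ → ℂ} (ha : Measurable a) (hs : Measurable s) :
    Measurable (bsum a s) := Measurable.tsum fun k => measurable_bs ha hs k

lemma pow_le_aux (t d : ℝ≥0∞) (hd : d ≤ 1) (N : ℕ) :
    (1 + d * t) ^ N ≤ 1 + d * (2 * (1 + t)) ^ N := by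
  induction N with
  | zero => simp
  | succ N ih =>
    have h1 : (1 : ℝ≥0∞) ≤ (2 * (1 + t)) ^ N := by
      apply one_le_pow₀
      calc (1 : ℝ≥0∞) ≤ 2 * (1 + 0) := by norm_num
        _ ≤ _ := by gcongr; simp
    calc (1 + d * t) ^ (N + 1) = (1 + d * t) ^ N * (1 + d * t) := pow_succ _ _
      _ ≤ (1 + d * (2 * (1 + t)) ^ N) * (1 + d * t) := by gcongr
      _ = 1 + d * (t * 1 + (2 * (1 + t)) ^ N * (1 + d * t)) := by ring
      _ ≤ 1 + d * ((1 + t) * (2 * (1 + t)) ^ N + (2 * (1 + t)) ^ N * (1 + 1 * t)) := by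
          gcongr
          simp
      _ = _ := by ring

lemma Wt_bsum {a s : ℂ → ℂ} (ha : Measurable a) (hs : Measurable s) {K : ℝ≥0∞}
    (hKt : K ≠ ∞) (hK : ∀ ξ, ‖s ξ‖ₑ ≤ K) (haW : Wt a) (hsmall : K * ∫⁻ ξ, ‖a ξ‖ₑ < 1) :
    Wt (bsum a s) := by
  refine ⟨(measurable_bsum ha hs).aestronglyMeasurable, fun N => ?_⟩
  set B : ℝ≥0∞ := ∫⁻ ξ, (2 * (1 + ‖ξ‖ₑ)) ^ N * ‖a ξ‖ₑ with hB
  have hBt : B ≠ ∞ := by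
    have := haW.2 N
    have h2 : B = 2 ^ N * ∫⁻ ξ, (1 + ‖ξ‖ₑ) ^ N * ‖a ξ‖ₑ := by
      rw [hB, ← lintegral_const_mul _ (by fun_prop)]
      refine lintegral_congr fun ξ => ?_
      rw [mul_pow]; ring
    rw [h2]
    exact ENNReal.mul_ne_top (by simp) this
  have hlim : Filter.Tendsto (fun d : ℝ≥0∞ => K * ((∫⁻ ξ, ‖a ξ‖ₑ) + d * B)) (𝓝[>] 0)
      (𝓝 (K * ((∫⁻ ξ, ‖a ξ‖ₑ) + 0 * B))) := by
    refine Filter.Tendsto.mono_left ?_ nhdsWithin_le_nhds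
    refine ENNReal.Tendsto.const_mul ?_ (Or.inr hKt)
    refine Filter.Tendsto.const_add _ ?_
    exact ENNReal.Tendsto.mul_const Filter.tendsto_id (Or.inr hBt)
  have hev := hlim.eventually_lt_const (u := 1) (by simpa using hsmall)
  have hev2 : ∀ᶠ d : ℝ≥0∞ in 𝓝[>] 0, d < 1 :=
    nhdsWithin_le_nhds (eventually_lt_nhds (by simp))
  obtain ⟨d, ⟨hd1, hd2⟩, hd3⟩ := ((hev.and hev2).and self_mem_nhdsWithin).exists
  have hd3 : 0 < d := hd3
  have hdt : d ≠ ∞ := ne_top_of_lt hd2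
  set W : ℂ → ℝ≥0∞ := fun ξ => (1 + d * ‖ξ‖ₑ) ^ N with hWdef
  have hW : Measurable W := by fun_prop
  have hadd : ∀ ξ η, W (ξ + η) ≤ W ξ * W η := by
    intro ξ η
    simp only [hWdef]
    rw [← mul_pow]
    gcongr
    calc 1 + d * ‖ξ + η‖ₑ ≤ 1 + d * (‖ξ‖ₑ + ‖η‖ₑ) := by gcongr; exact enorm_add_le _ _
      _ ≤ 1 + d * (‖ξ‖ₑ + ‖η‖ₑ) + (d * ‖ξ‖ₑ) * (d * ‖η‖ₑ) := le_self_add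
      _ = _ := by ring
  have hA : ∫⁻ ξ, W ξ * ‖a ξ‖ₑ ≤ (∫⁻ ξ, ‖a ξ‖ₑ) + d * B := by
    rw [hB, ← lintegral_const_mul _ (by fun_prop), ← lintegral_add_left (by fun_prop)]
    refine lintegral_mono fun ξ => ?_
    calc _ ≤ (1 + d * (2 * (1 + ‖ξ‖ₑ)) ^ N) * ‖a ξ‖ₑ := by
          gcongr; exact pow_le_aux _ _ hd2.le N
      _ = _ := by ring
  have hAt : ∫⁻ ξ, W ξ * ‖a ξ‖ₑ ≠ ∞ := by
    refine ne_top_of_le_ne_top ?_ hA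
    exact ENNReal.add_ne_top.2 ⟨(haW.integrable.2).ne, ENNReal.mul_ne_top hdt hBt⟩
  have hKA : K * ∫⁻ ξ, W ξ * ‖a ξ‖ₑ < 1 := lt_of_le_of_lt (by gcongr) hd1
  have main : ∫⁻ ξ, W ξ * ‖bsum a s ξ‖ₑ ≠ ∞ := by
    refine ne_top_of_le_ne_top ?_ (lintegral_bsum ha hs hK hW hadd)
    refine ENNReal.mul_ne_top hAt ?_
    simpa [tsub_eq_zero_iff_le] using hKA
  have hb := measurable_bsum ha hs
  have hdi : (d⁻¹) ^ N ≠ ∞ := by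
    refine ENNReal.pow_ne_top ?_
    simpa using hd3.ne'
  refine ne_top_of_le_ne_top (ENNReal.mul_ne_top hdi main) ?_
  rw [← lintegral_const_mul _ (by fun_prop)]
  refine lintegral_mono fun ξ => ?_
  rw [← mul_assoc, hWdef, ← mul_pow]
  gcongr
  rw [mul_add, ← mul_assoc, ENNReal.inv_mul_cancel hd3.ne' hdt]
  gcongr
  · simpa using hd2.le
  · simp

lemma norm_T_le (b : ℂ → ℂ) (z : ℂ) : ‖T b z‖ₑ ≤ ∫⁻ ξ, ‖b ξ‖ₑ := by
  refine (enorm_integral_le_lintegral_enorm _).trans (lintegral_mono fun ξ => ?_)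
  rw [enorm_mul, show ‖ee ξ z‖ₑ = 1 by rw [← ofReal_norm, norm_ee]; simp, one_mul]

lemma T_conv {a g : ℂ → ℂ} (ha : Integrable a) (hg : Integrable g) (z : ℂ) :
    T (fun ξ => ∫ η, a (ξ - η) * g η) z = T a z * T g z := by
  have h0 : Integrable (Function.uncurry fun ξ η : ℂ => a (ξ - η) * g η) (volume.prod volume) := by
    have := Integrable.convolution_integrand (μ := (volume : Measure ℂ)) (ν := (volume : Measure ℂ))
      (ContinuousLinearMap.mul ℝ ℂ) hg ha
    refine this.congr (Filter.Eventually.of_forall fun p => ?_)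
    simp [Function.uncurry, mul_comm]
  have h1 : Integrable (Function.uncurry fun ξ η : ℂ => ee ξ z * (a (ξ - η) * g η))
      (volume.prod volume) := by
    refine h0.bdd_mul (c := 1) (f := fun p : ℂ × ℂ => ee p.1 z) ?_ (Filter.Eventually.of_forall fun ξ => (norm_ee _ z).le)
    exact ((measurable_ee z).comp measurable_fst).aestronglyMeasurable
  calc T (fun ξ => ∫ η, a (ξ - η) * g η) z = ∫ ξ, ∫ η, ee ξ z * (a (ξ - η) * g η) := by
        unfold T
        congr 1; ext ξ
        rw [integral_const_mul]
    _ = ∫ η, ∫ ξ, ee ξ z * (a (ξ - η) * g η) := integral_integral_swap h1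
    _ = ∫ η, T a z * (ee η z * g η) := by
        congr 1; ext η
        have : ∀ ξ, ee ξ z * (a (ξ - η) * g η) = (ee (ξ - η) z * a (ξ - η)) * (ee η z * g η) := by
          intro ξ
          have := ee_add (ξ - η) η z
          rw [sub_add_cancel] at this
          rw [this]; ring
        simp_rw [this]
        rw [integral_mul_const, integral_sub_right_eq_self (fun ξ => ee ξ z * a ξ) η]
        rfl
    _ = _ := by rw [integral_const_mul]; rfl

lemma T_tsum {F : ℕ → ℂ → ℂ} (hF : ∀ k, Measurable (F k)) (h : ∑' k, ∫⁻ ξ, ‖F k ξ‖ₑ ≠ ∞) (z : ℂ) :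
    T (fun ξ => ∑' k, F k ξ) z = ∑' k, T (F k) z ∧ Summable (fun k => T (F k) z) := by
  constructor
  · unfold T
    simp_rw [← tsum_mul_left]
    refine integral_tsum (fun k => ((measurable_ee z).mul (hF k)).aestronglyMeasurable) ?_
    refine ne_top_of_le_ne_top h (ENNReal.tsum_le_tsum fun k => lintegral_mono fun ξ => ?_)
    rw [enorm_mul, show ‖ee ξ z‖ₑ = 1 by rw [← ofReal_norm, norm_ee]; simp, one_mul]
  · have : ∑' k, ‖T (F k) z‖ₑ ≠ ∞ :=
      ne_top_of_le_ne_top h (ENNReal.tsum_le_tsum fun k => norm_T_le _ z)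
    exact (tsum_enorm_ne_top_iff_summable_norm.1 this).of_norm

lemma T_bsum {a s : ℂ → ℂ} (ha : Measurable a) (hs : Measurable s) {K : ℝ≥0∞}
    (hKt : K ≠ ∞) (hK : ∀ ξ, ‖s ξ‖ₑ ≤ K) (hai : Integrable a)
    (hsmall : K * ∫⁻ ξ, ‖a ξ‖ₑ < 1) (z : ℂ) :
    T (bsum a s) z = T a z * (1 + T (fun ξ => s ξ * bsum a s ξ) z) := by
  have h1 : ∑' k, ∫⁻ ξ, ‖bs a s k ξ‖ₑ ≠ ∞ := by
    have := tsum_lintegral_bs ha hs hK (W := fun _ => 1) measurable_const (by simp)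
    simp only [one_mul] at this
    refine ne_top_of_le_ne_top ?_ this
    refine ENNReal.mul_ne_top hai.2.ne ?_
    simpa [tsub_eq_zero_iff_le] using hsmall
  have hk : ∀ k, ∫⁻ ξ, ‖s ξ * bs a s k ξ‖ₑ ≤ K * ∫⁻ ξ, ‖bs a s k ξ‖ₑ := by
    intro k
    have := measurable_bs ha hs k
    rw [← lintegral_const_mul _ (by fun_prop)]
    refine lintegral_mono fun ξ => ?_
    rw [enorm_mul]; gcongr; exact hK ξ
  have h2 : ∑' k, ∫⁻ ξ, ‖s ξ * bs a s k ξ‖ₑ ≠ ∞ := by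
    refine ne_top_of_le_ne_top (ENNReal.mul_ne_top hKt h1) ?_
    rw [← ENNReal.tsum_mul_left]
    exact ENNReal.tsum_le_tsum hk
  obtain ⟨e1, s1⟩ := T_tsum (fun k => measurable_bs ha hs k) h1 z
  obtain ⟨e2, s2⟩ := T_tsum (F := fun k ξ => s ξ * bs a s k ξ)
    (fun k => hs.mul (measurable_bs ha hs k)) h2 z
  have e3 : T (fun ξ => s ξ * bsum a s ξ) z = ∑' k, T (fun ξ => s ξ * bs a s k ξ) z := by
    rw [← e2]; unfold bsum; simp_rw [tsum_mul_left]
  have e4 : T (bsum a s) z = ∑' k, T (bs a s k) z := e1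
  rw [e4, e3, s1.tsum_eq_zero_add, mul_add, mul_one, ← tsum_mul_left]
  congr 1
  refine tsum_congr fun k => ?_
  have hki : Integrable (fun ξ => s ξ * bs a s k ξ) := by
    refine ⟨(hs.mul (measurable_bs ha hs k)).aestronglyMeasurable, ?_⟩
    exact lt_of_le_of_lt (ENNReal.le_tsum k) h2.lt_top
  exact T_conv hai hki z

theorem core {c : ℂ} (hc : ‖c‖ < 1) {a : ℂ → ℂ} (ha : Measurable a) (haW : Wt a)
    (hsm : ∫⁻ ξ, ‖a ξ‖ₑ ≤ ENNReal.ofReal ((1 - ‖c‖) ^ 2 / 8)) :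
    ∃ W : ℂ → ℂ, ContDiff ℝ (⊤ : ℕ∞) W ∧ Function.Injective W ∧
      ∀ z, ∃ A : ℂ, A ≠ 0 ∧ HasFDerivAt W (lin A ((c + T a z) * A)) z := by
  set δ : ℝ := 1 - ‖c‖ with hδdef
  have hδ : 0 < δ := by rw [hδdef]; linarith
  have hδ1 : δ ≤ 1 := by rw [hδdef]; linarith [norm_nonneg c]
  set D : ℂ → ℂ := fun ξ => ξ - c * conj ξ with hD
  have hDm : Measurable D := (by fun_prop : Continuous D).measurable
  have hDn : ∀ ξ, δ * ‖ξ‖ ≤ ‖D ξ‖ := by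
    intro ξ
    have := norm_sub_norm_le ξ (c * conj ξ)
    rw [norm_mul, RCLike.norm_conj] at this
    calc δ * ‖ξ‖ = ‖ξ‖ - ‖c‖ * ‖ξ‖ := by rw [hδdef]; ring
      _ ≤ _ := this
  have hDq : ∀ ξ, ‖ξ‖ / ‖D ξ‖ ≤ δ⁻¹ := by
    intro ξ
    rcases eq_or_ne ξ 0 with rfl | h
    · simp; positivity
    · have h1 : 0 < ‖D ξ‖ := lt_of_lt_of_le (by positivity) (hDn ξ)
      rw [div_le_iff₀ h1, ← div_eq_inv_mul, le_div_iff₀ hδ]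
      linarith [hDn ξ]
  set s : ℂ → ℂ := fun ξ => conj ξ / D ξ with hs
  set s' : ℂ → ℂ := fun ξ => ξ / D ξ with hs'
  have hsM : Measurable s := ((by fun_prop : Continuous fun ξ : ℂ => conj ξ).measurable).div hDm
  have hsM' : Measurable s' := measurable_id.div hDm
  set K : ℝ≥0∞ := ENNReal.ofReal δ⁻¹ with hK
  have hKt : K ≠ ∞ := ENNReal.ofReal_ne_top
  have hsK : ∀ ξ, ‖s ξ‖ₑ ≤ K := by
    intro ξ
    rw [← ofReal_norm]
    refine ENNReal.ofReal_le_ofReal ?_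
    simpa [hs] using hDq ξ
  have hsK' : ∀ ξ, ‖s' ξ‖ₑ ≤ K := by
    intro ξ
    rw [← ofReal_norm]
    refine ENNReal.ofReal_le_ofReal ?_
    simpa [hs'] using hDq ξ
  have hKA : K * ∫⁻ ξ, ‖a ξ‖ₑ ≤ ENNReal.ofReal (1 / 2) := by
    calc _ ≤ K * ENNReal.ofReal (δ ^ 2 / 8) := by gcongr
      _ = ENNReal.ofReal (δ⁻¹ * (δ ^ 2 / 8)) := by rw [ENNReal.ofReal_mul (by positivity)]
      _ ≤ _ := by
        apply ENNReal.ofReal_le_ofReal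
        have : δ⁻¹ * (δ ^ 2 / 8) = δ / 8 := by field_simp
        rw [this]; linarith
  have hsmall : K * ∫⁻ ξ, ‖a ξ‖ₑ < 1 := by
    refine lt_of_le_of_lt hKA ?_
    rw [← ENNReal.ofReal_one]
    exact (ENNReal.ofReal_lt_ofReal_iff one_pos).2 (by norm_num)
  set b := bsum a s with hb
  have hbm : Measurable b := measurable_bsum ha hsM
  have hbW : Wt b := Wt_bsum ha hsM hKt hsK haW hsmall
  have hbn : ∫⁻ ξ, ‖b ξ‖ₑ ≤ ENNReal.ofReal (δ ^ 2 / 4) := by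
    have := lintegral_bsum ha hsM hsK (W := fun _ => 1) measurable_const (by simp)
    simp only [one_mul] at this
    refine this.trans ?_
    calc _ ≤ ENNReal.ofReal (δ ^ 2 / 8) * (1 - ENNReal.ofReal (1 / 2))⁻¹ := by gcongr
      _ = ENNReal.ofReal (δ ^ 2 / 8) * ENNReal.ofReal 2 := by
        congr 1
        rw [← ENNReal.ofReal_one, ← ENNReal.ofReal_sub _ (by norm_num),
          ← ENNReal.ofReal_inv_of_pos (by norm_num)]
        norm_num
      _ = _ := by
        rw [← ENNReal.ofReal_mul (by positivity)]; congr 1; ring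
  have hTb : ∀ {r : ℂ → ℂ}, (∀ ξ, ‖r ξ‖ₑ ≤ K) → ∀ z, ‖T (fun ξ => r ξ * b ξ) z‖ ≤ δ / 4 := by
    intro r hr z
    rw [← ENNReal.ofReal_le_ofReal_iff (by positivity), ofReal_norm]
    refine (norm_T_le _ z).trans ?_
    calc _ ≤ ∫⁻ ξ, K * ‖b ξ‖ₑ := lintegral_mono fun ξ => by
            rw [enorm_mul]; gcongr; exact hr ξ
      _ = K * ∫⁻ ξ, ‖b ξ‖ₑ := by rw [lintegral_const_mul _ (by fun_prop)]
      _ ≤ K * ENNReal.ofReal (δ ^ 2 / 4) := by gcongr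
      _ = ENNReal.ofReal (δ⁻¹ * (δ ^ 2 / 4)) := by rw [ENNReal.ofReal_mul (by positivity)]
      _ = _ := by congr 1; field_simp
  have hWr : ∀ {r : ℂ → ℂ}, Measurable r → (∀ ξ, ‖r ξ‖ₑ ≤ K) → Wt (fun ξ => r ξ * b ξ) := by
    intro r hrm hr
    refine hbW.mul hrm.aestronglyMeasurable hKt fun ξ => (hr ξ).trans ?_
    calc K = K * (1 + 0) := by simp
      _ ≤ _ := by gcongr; simp
  set G : ℂ → ℂ := T (fun ξ => s ξ * b ξ) with hG
  set H : ℂ → ℂ := T (fun ξ => s' ξ * b ξ) with hH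
  have hpi : (Real.pi * Complex.I : ℂ) ≠ 0 := by
    simp [Real.pi_ne_zero]
  set m : ℂ → ℂ := fun ξ => (Real.pi * Complex.I : ℂ)⁻¹ * (b ξ / D ξ) with hm
  have hmm : Measurable m := (hbm.div hDm).const_mul _
  have hmi : Integrable (fun ξ => ξ * m ξ) := by
    refine ((hWr hsM' hsK').integrable.const_mul (Real.pi * Complex.I : ℂ)⁻¹).congr
      (Filter.Eventually.of_forall fun ξ => ?_)
    simp only [hm, hs']; ring
  have hder : ∀ z, HasFDerivAt (P m) (lin (G z) (H z)) z := by
    intro z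
    have := hasFDerivAt_P hmm.aestronglyMeasurable hmi z
    have e1 : (fun ξ => Real.pi * Complex.I * conj ξ * m ξ) = fun ξ => s ξ * b ξ := by
      ext ξ; simp only [hm, hs]; field_simp
    have e2 : (fun ξ => Real.pi * Complex.I * ξ * m ξ) = fun ξ => s' ξ * b ξ := by
      ext ξ; simp only [hm, hs']; field_simp
    rwa [e1, e2] at this
  have hrel : ∀ z, H z - c * G z = T a z * (1 + G z) := by
    intro z
    rw [hG, ← T_bsum ha hsM hKt hsK haW.integrable hsmall z]
    simp only [hH, T]
    rw [← integral_const_mul, ← integral_sub]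
    · refine integral_congr_ae ?_
      have : ∀ᵐ ξ : ℂ, ξ ≠ 0 := by
        simp [ae_iff]
      filter_upwards [this] with ξ hξ
      have hDξ : D ξ ≠ 0 := by
        have := hDn ξ
        intro h0
        rw [h0, norm_zero] at this
        have h3 : 0 < δ * ‖ξ‖ := by positivity
        linarith
      have h4 : s' ξ - c * s ξ = 1 := by
        simp only [hs, hs']
        rw [mul_div_assoc', ← sub_div]
        exact div_self hDξ
      linear_combination (ee ξ z * b ξ) * h4
    · exact integrable_ee_mul (hWr hsM' hsK').integrable z
    · exact (integrable_ee_mul (hWr hsM hsK).integrable z).const_mul c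
  have hWd : ∀ z, HasFDerivAt (fun z => lin 1 c z + P m z) (lin (1 + G z) (c + H z)) z := by
    intro z
    refine ((lin 1 c).hasFDerivAt.add (hder z)).congr_fderiv ?_
    ext v <;> simp [lin_apply] <;> ring
  refine ⟨fun z => lin 1 c z + P m z, ?_, ?_, ?_⟩
  · rw [contDiff_infty_iff_fderiv]
    refine ⟨fun z => (hWd z).differentiableAt, ?_⟩
    rw [show fderiv ℝ (fun z => lin 1 c z + P m z) = fun z => lin (1 + G z) (c + H z) from
      funext fun z => (hWd z).fderiv]
    unfold lin
    exact ((contDiff_const.add (contDiff_T (hWr hsM hsK))).smul contDiff_const).add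
      ((contDiff_const.add (contDiff_T (hWr hsM' hsK'))).smul contDiff_const)
  · intro x y hxy
    have hxy : lin 1 c x + P m x = lin 1 c y + P m y := hxy
    have h1 : ‖P m y - P m x‖ ≤ (δ / 2) * ‖y - x‖ := by
      refine Convex.norm_image_sub_le_of_norm_hasFDerivWithin_le (s := Set.univ)
        (fun z _ => (hder z).hasFDerivWithinAt) (fun z _ => ?_) convex_univ trivial trivial
      refine (norm_lin_le _ _).trans ?_
      have := hTb hsK z
      have := hTb hsK' z
      simp only [hG, hH]
      linarith
    have h2 : P m y - P m x = - ((y - x) + c * conj (y - x)) := by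
      rw [lin_apply, lin_apply] at hxy
      rw [map_sub]
      linear_combination -hxy
    rw [h2, norm_neg] at h1
    have h3 : ‖y - x‖ - ‖c * conj (y - x)‖ ≤ ‖(y - x) + c * conj (y - x)‖ := by
      simpa using norm_sub_norm_le (y - x) (-(c * conj (y - x)))
    rw [norm_mul, RCLike.norm_conj] at h3
    have h4 : δ * ‖y - x‖ = ‖y - x‖ - ‖c‖ * ‖y - x‖ := by rw [hδdef]; ring
    have h5 : ‖y - x‖ ≤ 0 := by
      by_contra hlt
      push Not at hlt
      nlinarith [mul_pos hδ hlt]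
    have h6 : y - x = 0 := norm_le_zero_iff.1 h5
    exact (sub_eq_zero.1 h6).symm
  · intro z
    refine ⟨1 + G z, ?_, ?_⟩
    · intro h0
      have h1 : ‖G z‖ ≤ δ / 4 := hTb hsK z
      have h2 : G z = -1 := by linear_combination h0
      rw [h2] at h1
      norm_num at h1
      linarith
    · have : (c + T a z) * (1 + G z) = c + H z := by linear_combination - hrel z
      rw [this]
      exact hWd z

open scoped FourierTransform

/-- sum of the integrals of the first derivatives -/
noncomputable def M (n : ℕ) (g : ℂ → ℂ) : ℝ :=
  ∑ p ∈ Finset.range (n + 1), ∫ v, ‖iteratedFDeriv ℝ p g v‖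

lemma M_zero_le (n : ℕ) (g : ℂ → ℂ) : M 0 g ≤ M n g := by
  unfold M
  refine Finset.sum_le_sum_of_subset_of_nonneg ?_ fun _ _ _ => integral_nonneg fun _ => norm_nonneg _
  simp

lemma M_nonneg (n : ℕ) (g : ℂ → ℂ) : 0 ≤ M n g :=
  Finset.sum_nonneg fun _ _ => integral_nonneg fun _ => norm_nonneg _

lemma fourier_bound {g : ℂ → ℂ} (hg : ContDiff ℝ (⊤ : ℕ∞) g) (hs : HasCompactSupport g)
    (n : ℕ) (ξ : ℂ) : ‖ξ‖ ^ n * ‖𝓕 g ξ‖ ≤ 2 ^ n * M n g := by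
  have := Real.pow_mul_norm_iteratedFDeriv_fourier_le (K := ⊤) (N := ⊤) (f := g) hg ?_
    (k := 0) (n := n) (by simp) (by exact_mod_cast le_top) ξ
  · simp only [norm_iteratedFDeriv_zero] at this
    refine this.trans (le_of_eq ?_)
    simp [M]
  · intro k n _ hn
    refine Continuous.integrable_of_hasCompactSupport ?_ ?_
    · have := hg.continuous_iteratedFDeriv (m := n) (by exact_mod_cast hn)
      fun_prop
    · exact ((hs.iteratedFDeriv n).norm).mul_left

lemma fourier_bound' {g : ℂ → ℂ} (hg : ContDiff ℝ (⊤ : ℕ∞) g) (hs : HasCompactSupport g)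
    (n : ℕ) (ξ : ℂ) : (1 + ‖ξ‖) ^ n * ‖𝓕 g ξ‖ ≤ 2 ^ (n - 1) * (1 + 2 ^ n) * M n g := by
  have h1 := fourier_bound hg hs n ξ
  have h0 := fourier_bound hg hs 0 ξ
  have h2 := M_zero_le n g
  have h3 := add_pow_le zero_le_one (norm_nonneg ξ) n
  simp only [pow_zero, one_mul, one_pow] at h0 h3
  calc (1 + ‖ξ‖) ^ n * ‖𝓕 g ξ‖ ≤ (2 ^ (n - 1) * (1 + ‖ξ‖ ^ n)) * ‖𝓕 g ξ‖ := by gcongr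
    _ = 2 ^ (n - 1) * (‖𝓕 g ξ‖ + ‖ξ‖ ^ n * ‖𝓕 g ξ‖) := by ring
    _ ≤ 2 ^ (n - 1) * (M n g + 2 ^ n * M n g) := by gcongr; linarith
    _ = _ := by ring

/-- the integral of the weight -/
noncomputable def J : ℝ≥0∞ := ∫⁻ ξ : ℂ, ENNReal.ofReal ((1 + ‖ξ‖) ^ (-3 : ℝ))

lemma J_ne_top : J ≠ ∞ := by
  have : Integrable (fun ξ : ℂ => (1 + ‖ξ‖) ^ (-3 : ℝ)) :=
    integrable_one_add_norm (by simp; norm_num)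
  exact (this.lintegral_lt_top).ne

lemma fourier_lint {g : ℂ → ℂ} (hg : ContDiff ℝ (⊤ : ℕ∞) g) (hs : HasCompactSupport g) (N : ℕ) :
    ∫⁻ ξ, (1 + ‖ξ‖ₑ) ^ N * ‖𝓕 g ξ‖ₑ ≤
      ENNReal.ofReal (2 ^ (N + 3 - 1) * (1 + 2 ^ (N + 3)) * M (N + 3) g) * J := by
  rw [J, ← lintegral_const_mul' _ _ ENNReal.ofReal_ne_top]
  refine lintegral_mono fun ξ => ?_
  have hM := M_nonneg (N + 3) g
  have e : (1 + ‖ξ‖ₑ) = ENNReal.ofReal (1 + ‖ξ‖) := by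
    rw [ENNReal.ofReal_add zero_le_one (norm_nonneg _), ofReal_norm, ENNReal.ofReal_one]
  rw [e, ← ENNReal.ofReal_pow (by positivity), ← ofReal_norm,
    ← ENNReal.ofReal_mul (by positivity), ← ENNReal.ofReal_mul (by positivity)]
  refine ENNReal.ofReal_le_ofReal ?_
  have h := fourier_bound' hg hs (N + 3) ξ
  rw [Real.rpow_neg (by positivity), ← div_eq_mul_inv, le_div_iff₀ (by positivity)]
  refine le_trans (le_of_eq ?_) h
  rw [pow_add]
  norm_cast
  ring

lemma continuous_fourier {g : ℂ → ℂ} (hg : Integrable g) : Continuous (𝓕 g) :=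
  VectorFourier.fourierIntegral_continuous Real.continuous_fourierChar
    (by exact continuous_inner) hg

lemma Wt_fourier {g : ℂ → ℂ} (hg : ContDiff ℝ (⊤ : ℕ∞) g) (hs : HasCompactSupport g) :
    Wt (𝓕 g) := by
  refine ⟨(continuous_fourier (hg.continuous.integrable_of_hasCompactSupport hs)).aestronglyMeasurable, fun N => ?_⟩
  exact ne_top_of_le_ne_top (ENNReal.mul_ne_top ENNReal.ofReal_ne_top J_ne_top)
    (fourier_lint hg hs N)

lemma T_fourier {g : ℂ → ℂ} (hg : ContDiff ℝ (⊤ : ℕ∞) g) (hs : HasCompactSupport g) (z : ℂ) :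
    T (𝓕 g) z = g z := by
  have := hg.continuous.fourierInv_fourier_eq (hg.continuous.integrable_of_hasCompactSupport hs)
    (Wt_fourier hg hs).integrable
  conv_rhs => rw [← this]
  rw [Real.fourierInv_eq', T]
  congr 1; ext ξ
  rw [ee_real, smul_eq_mul, Complex.inner, mul_comm z]

lemma small {F : ℝ × ℂ → ℂ} (hF : ContDiff ℝ (⊤ : ℕ∞) F) (h0 : ∀ z, F (0, z) = 0)
    (hs : ∀ e z, z ∉ Metric.closedBall (0 : ℂ) 2 → F (e, z) = 0) (n : ℕ) :
    Filter.Tendsto (fun e => M n (fun z => F (e, z))) (𝓝 0) (𝓝 0) := by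
  have hd : ∀ p e z, iteratedFDeriv ℝ p (fun z => F (e, z)) z =
      (iteratedFDeriv ℝ p F (e, z)).compContinuousLinearMap
        (fun _ => ContinuousLinearMap.inr ℝ ℝ ℂ) := by
    intro p e z
    have h1 : ContDiff ℝ (⊤ : ℕ∞) (fun q => F ((e, 0) + q)) := hF.comp (contDiff_const.add contDiff_id)
    have h2 := (ContinuousLinearMap.inr ℝ ℝ ℂ).iteratedFDeriv_comp_right h1 z (i := p)
      (by exact_mod_cast le_top)
    rw [iteratedFDeriv_comp_add_left] at h2
    simpa [Function.comp_def] using h2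
  have hc : ∀ p, Continuous (Function.uncurry fun (e : ℝ) (z : ℂ) =>
      ‖iteratedFDeriv ℝ p (fun z => F (e, z)) z‖) := by
    intro p
    simp_rw [hd]
    have h1 := hF.continuous_iteratedFDeriv (m := p) (by exact_mod_cast le_top)
    have h2 := (ContinuousMultilinearMap.compContinuousLinearMapL (𝕜 := ℝ) (F := ℂ)
      (fun _ : Fin p => ContinuousLinearMap.inr ℝ ℝ ℂ)).continuous
    exact (h2.comp h1).norm
  have hi : ∀ p e, ∫ v, ‖iteratedFDeriv ℝ p (fun z => F (e, z)) v‖ =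
      ∫ v in Metric.closedBall (0 : ℂ) 2, ‖iteratedFDeriv ℝ p (fun z => F (e, z)) v‖ := by
    intro p e
    refine (setIntegral_eq_integral_of_forall_compl_eq_zero fun v hv => ?_).symm
    rw [norm_eq_zero]
    have h1 : tsupport (fun z => F (e, z)) ⊆ Metric.closedBall (0 : ℂ) 2 := by
      refine closure_minimal (fun z hz => ?_) Metric.isClosed_closedBall
      by_contra hh
      exact hz (hs e z hh)
    have h2 := support_iteratedFDeriv_subset (𝕜 := ℝ) (f := fun z => F (e, z)) p
    by_contra hh
    exact hv (h1 (h2 hh))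
  have hcont : Continuous (fun e => M n (fun z => F (e, z))) := by
    unfold M
    simp_rw [hi]
    refine continuous_finsetSum _ fun p _ => ?_
    exact continuous_parametric_integral_of_continuous (hc p) (isCompact_closedBall _ _)
  have := hcont.tendsto 0
  have e0 : M n (fun z => F (0, z)) = 0 := by
    simp_rw [h0]
    unfold M
    refine Finset.sum_eq_zero fun p _ => ?_
    have : (fun _ : ℂ => (0 : ℂ)) = 0 := rfl
    rw [this]
    simp
  rwa [e0] at this

end KL

/-- **Local integrability of smooth almost complex structures (Korn–Lichtenstein).**
If `μ` is `C^∞` on a disc `D = B(0,R)` with `|μ| < 1` on `D`, then on some open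
neighborhood `U ⊆ D` of `0` there is an injective `C^∞` map `w` with
`∂w/∂z̄ = μ ∂w/∂z` and `∂w/∂z ≠ 0` on `U` (a local `σ_μ`-holomorphic univalent
coordinate). -/
theorem local_integrability
    (R : ℝ) (hR : 0 < R) (μ : ℂ → ℂ)
    (hμ : ContDiffOn ℝ (⊤ : ℕ∞) μ (Metric.ball (0:ℂ) R))
    (hbound : ∀ z ∈ Metric.ball (0:ℂ) R, ‖μ z‖ < 1) :
    ∃ U : Set ℂ, IsOpen U ∧ (0:ℂ) ∈ U ∧ U ⊆ Metric.ball (0:ℂ) R ∧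
      ∃ w : ℂ → ℂ, ContDiffOn ℝ (⊤ : ℕ∞) w U ∧ Set.InjOn w U ∧
        ∀ z ∈ U, wderivBar w z = μ z * wderiv w z ∧ wderiv w z ≠ 0 := by
  have hc : ‖μ 0‖ < 1 := hbound 0 (Metric.mem_ball_self hR)
  set c := μ 0 with hcdef
  let χR : ContDiffBump (0 : ℂ) := ⟨R / 3, R / 2, by positivity, by linarith⟩
  let χ : ContDiffBump (0 : ℂ) := ⟨1, 2, by norm_num, by norm_num⟩
  set μ0 : ℂ → ℂ := fun z => (χR z : ℂ) * (μ z - c) with hμ0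
  have hμ0s : ContDiff ℝ (⊤ : ℕ∞) μ0 := by
    rw [contDiff_iff_contDiffAt]
    intro z
    by_cases hz : z ∈ Metric.ball (0 : ℂ) R
    · have h1 : ContDiffAt ℝ (⊤ : ℕ∞) μ z := (hμ z hz).contDiffAt (Metric.isOpen_ball.mem_nhds hz)
      have h2 : ContDiffAt ℝ (⊤ : ℕ∞) (fun z => (χR z : ℂ)) z :=
        Complex.ofRealCLM.contDiff.contDiffAt.comp z χR.contDiffAt
      exact h2.mul (h1.sub contDiffAt_const)
    · have hz' : z ∈ (Metric.closedBall (0 : ℂ) (R / 2))ᶜ := by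
        simp only [Metric.mem_ball, Metric.mem_closedBall, Set.mem_compl_iff, not_lt, not_le] at hz ⊢
        linarith
      refine (contDiffAt_const (c := (0 : ℂ))).congr_of_eventuallyEq ?_
      filter_upwards [Metric.isClosed_closedBall.isOpen_compl.mem_nhds hz'] with y hy
      have : χR y = 0 := χR.zero_of_le_dist (by
        simp only [Metric.mem_closedBall, Set.mem_compl_iff, not_le] at hy
        exact hy.le)
      simp [hμ0, this]
  set F : ℝ × ℂ → ℂ := fun q => (χ q.2 : ℂ) * μ0 (q.1 • q.2) with hF
  have hFs : ContDiff ℝ (⊤ : ℕ∞) F := by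
    have h1 : ContDiff ℝ (⊤ : ℕ∞) (fun q : ℝ × ℂ => (χ q.2 : ℂ)) :=
      Complex.ofRealCLM.contDiff.comp (χ.contDiff.comp contDiff_snd)
    exact h1.mul (hμ0s.comp (contDiff_fst.smul contDiff_snd))
  have hF0 : ∀ z, F (0, z) = 0 := by
    intro z; simp [hF, hμ0, hcdef]
  have hFsupp : ∀ e z, z ∉ Metric.closedBall (0 : ℂ) 2 → F (e, z) = 0 := by
    intro e z hz
    have : χ z = 0 := χ.zero_of_le_dist (by
        simp only [Metric.mem_closedBall, not_le] at hz
        exact hz.le)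
    simp [hF, this]
  have hlim := KL.small hFs hF0 hFsupp 3
  have hδ : 0 < (1 - ‖c‖) ^ 2 / 8 := by
    have : 0 < 1 - ‖c‖ := by linarith
    positivity
  have hlim2 : Filter.Tendsto (fun e : ℝ => ENNReal.ofReal (2 ^ (0 + 3 - 1) * (1 + 2 ^ (0 + 3)) *
      KL.M (0 + 3) (fun z => F (e, z))) * KL.J) (nhds 0) (nhds 0) := by
    have h1 := hlim.const_mul ((2 : ℝ) ^ (0 + 3 - 1) * (1 + 2 ^ (0 + 3)))
    have h2 := ENNReal.Tendsto.mul_const (ENNReal.tendsto_ofReal h1) (Or.inr KL.J_ne_top)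
    simpa using h2
  have hev := (hlim2.eventually_lt_const (ENNReal.ofReal_pos.2 hδ)).filter_mono
    (nhdsWithin_le_nhds (s := Set.Ioi 0))
  have hev2 : ∀ᶠ e : ℝ in nhdsWithin 0 (Set.Ioi 0), e < R / 3 :=
    nhdsWithin_le_nhds (eventually_lt_nhds (by positivity))
  obtain ⟨e, ⟨he1, he2⟩, he3⟩ := ((hev.and hev2).and self_mem_nhdsWithin).exists
  have he : 0 < e := he3
  set g : ℂ → ℂ := fun z => F (e, z) with hg
  have hgs : ContDiff ℝ (⊤ : ℕ∞) g := hFs.comp (contDiff_const.prodMk contDiff_id)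
  have hgc : HasCompactSupport g :=
    HasCompactSupport.intro (isCompact_closedBall (0 : ℂ) 2) (fun z hz => hFsupp e z hz)
  have hint : Integrable g := hgs.continuous.integrable_of_hasCompactSupport hgc
  obtain ⟨W, hWs, hWi, hWd⟩ := KL.core (c := c) hc (a := FourierTransform.fourier g)
    (KL.continuous_fourier hint).measurable (KL.Wt_fourier hgs hgc) (by
      have := (KL.fourier_lint hgs hgc 0).trans he1.le
      simpa using this)
  refine ⟨Metric.ball 0 e, Metric.isOpen_ball, Metric.mem_ball_self he,
    Metric.ball_subset_ball (by linarith), fun z => W (e⁻¹ • z), ?_, ?_, ?_⟩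
  · exact (hWs.comp (contDiff_const_smul e⁻¹)).contDiffOn
  · intro x _ y _ hxy
    exact smul_right_injective ℂ (inv_ne_zero he.ne') (hWi hxy)
  · intro z hz
    obtain ⟨A, hA, hd⟩ := hWd (e⁻¹ • z)
    rw [mem_ball_zero_iff] at hz
    have hgz : c + KL.T (FourierTransform.fourier g) (e⁻¹ • z) = μ z := by
      rw [KL.T_fourier hgs hgc]
      have h1 : χ (e⁻¹ • z) = 1 := χ.one_of_mem_closedBall (by
        rw [mem_closedBall_zero_iff, norm_smul, norm_inv, Real.norm_of_nonneg he.le,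
          inv_mul_le_iff₀ he]
        change ‖z‖ ≤ e * 1
        linarith)
      have h2 : χR z = 1 := χR.one_of_mem_closedBall (by
        rw [mem_closedBall_zero_iff]
        change ‖z‖ ≤ R / 3
        linarith)
      simp only [hg, hF, hμ0]
      rw [h1, smul_inv_smul₀ he.ne', h2]
      simp
    rw [hgz] at hd
    have hd2 : HasFDerivAt (fun z => W (e⁻¹ • z))
        (KL.lin ((e⁻¹ : ℝ) * A) ((e⁻¹ : ℝ) * (μ z * A))) z := by
      have h1 : HasFDerivAt (fun z : ℂ => e⁻¹ • z) (e⁻¹ • ContinuousLinearMap.id ℝ ℂ) z :=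
        (hasFDerivAt_id z).const_smul e⁻¹
      refine (hd.comp z h1).congr_fderiv ?_
      ext v
      simp [KL.lin_apply]; ring
    rw [KL.wderiv_of hd2, KL.wderivBar_of hd2]
    refine ⟨by ring, mul_ne_zero ?_ hA⟩
    exact_mod_cast inv_ne_zero he.ne'
end
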